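/- arXiv:math/0405072 — 3 statements merged into one kernel-verified Lean document; each statement's English description precedes it below -/
import Mathlib

section
/- (Self-duality of elliptic 6j-symbols.) Let N be a nonnegative integer and η ∈ (ℝ_N ∪ 𝕀_N) with η ≠ 0. Let a, b, c, d ∈ ℂ be such that the four families (e_k^N(·;a,b))_{k=0}^N, (e_l^N(·;c,d))_{l=0}^N, (e_k^N(·;η(1−N)−b, η(1−N)−a))_{k=0}^N and (e_l^N(·;η(1−N)−d, η(1−N)−c))_{l=0}^N are each bases of Θ_N. Let R_k^l be the transition coefficients determined by e_k^N(x;a,b) = Σ_{l=0}^N R_k^l e_l^N(x;c,d), and let R′_l^k be determined by e_l^N(x; η(1−N)−d, η(1−N)−c) = Σ_{k=0}^N R′_l^k e_k^N(x; η(1−N)−b, η(1−N)−a). Then, with λ = (c−d−2Nη)/(2η) and μ = (a−b−2Nη)/(2η), and provided all factors below are nonzero, R_k^l = ([μ+1, (a+b)/(2η)]_N / [λ+1, (c+d)/(2η)]_N) · ([λ+2l]/[λ]) · ([−N, λ]_l / [1, λ+N+1]_l) · ([μ]/[μ+2k]) · ([1, μ+N+1]_k / [−N, μ]_k) · R′_l^k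 for all 0 ≤ k, l ≤ N. -/
noncomputable section
open Complex MeasureTheory

def cπ : ℂ := Real.pi

/-- Jacobi's first theta function θ₁(x|τ). -/
def θf (τ x : ℂ) : ℂ :=
  I * ∑' n : ℤ, (-1 : ℂ) ^ n *
    Complex.exp (cπ * I * τ * ((n : ℂ) - 1/2)^2 + cπ * I * (2*(n : ℂ) - 1) * x)

/-- The space Θ_N of even theta functions of order 2N. -/
def ThetaSp (τ : ℂ) (N : ℕ) (f : ℂ → ℂ) : Prop :=
  Differentiable ℂ f ∧ (∀ x, f (x + 1) = f x) ∧
  (∀ x, f (x + τ) = Complex.exp (-2*cπ*I*N*(2*x + τ)) * f x) ∧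
  (∀ x, f (-x) = f x)

/-- Sklyanin's weight function M(u,v). -/
def Mw (τ η : ℂ) (N : ℕ) (u v : ℂ) : ℂ :=
  θf τ (2*u) * θf τ (2*v) /
    (Complex.exp (2*cπ*I*u*(N+2)) *
      ∏ k ∈ Finset.range (N+2),
        (θf τ (u + v + (2*(k:ℂ) - N - 1)*η + 1/2 + τ/2) *
         θf τ (u - v + (2*(k:ℂ) - N - 1)*η + 1/2 + τ/2)))

/-- Sklyanin's invariant pairing, with τ = t * I. -/
def pairing (τ η : ℂ) (t : ℝ) (N : ℕ) (f g : ℂ → ℂ) : ℂ :=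
  ∫ y in (0:ℝ)..t, ∫ x in (0:ℝ)..(1:ℝ),
    f (x + y*I) * (starRingEnd ℂ) (g (x + y*I)) *
      Mw τ η N (x + y*I) ((starRingEnd ℂ) (x + y*I))

/-- The numerator defining the difference operator Δ(a). -/
def ΔRHS (τ η : ℂ) (N : ℕ) (a₁ a₂ a₃ a₄ : ℂ) (f : ℂ → ℂ) (x : ℂ) : ℂ :=
  θf τ (x + a₁ - N*η/2) * θf τ (x + a₂ - N*η/2) * θf τ (x + a₃ - N*η/2) *
    θf τ (x + a₄ - N*η/2) * f (x + η)
  - θf τ (x - a₁ + N*η/2) * θf τ (x - a₂ + N*η/2) * θf τ (x - a₃ + N*η/2) *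
    θf τ (x - a₄ + N*η/2) * f (x - η)

/-- The involution σ on Θ_N. -/
def σop (τ : ℂ) (N : ℕ) (f : ℂ → ℂ) (x : ℂ) : ℂ :=
  Complex.exp (2*cπ*I*N*(1/4 + τ/4 + x)) * f (x + 1/2 + τ/2)

/-- q-Pochhammer infinite product (a;p)_∞. -/
def qPoch (a p : ℂ) : ℂ := ∏' j : ℕ, (1 - a * p^j)

/-- The constant C of Theorem 3.2. -/
def Cconst (τ η : ℂ) (N : ℕ) : ℂ :=
  2*η * Complex.exp (2*cπ*I*τ*(3/8)) /
    (θf τ (2*(N+1)*η) *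
      (qPoch (Complex.exp (2*cπ*I*τ)) (Complex.exp (2*cπ*I*τ)))^3)

/-- The kernel K(u,w). -/
def Kk (τ η : ℂ) (N : ℕ) (u w : ℂ) : ℂ :=
  Complex.exp (2*cπ*I*u*(N:ℂ)) *
  ∏ k ∈ Finset.range N,
    (θf τ (u + w + (2*(k:ℂ) - N + 1)*η + 1/2 + τ/2) *
     θf τ (u - w + (2*(k:ℂ) - N + 1)*η + 1/2 + τ/2))

/-- The basis functions e_k^N(x;a,b). -/
def ekN (τ η : ℂ) (N k : ℕ) (a b : ℂ) (x : ℂ) : ℂ :=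
  (∏ j ∈ Finset.range k, (θf τ (a + x + 2*(j:ℂ)*η) * θf τ (a - x + 2*(j:ℂ)*η))) *
  (∏ j ∈ Finset.range (N - k), (θf τ (b + x + 2*(j:ℂ)*η) * θf τ (b - x + 2*(j:ℂ)*η)))

/-- Elliptic number [x] = θ(2ηx). -/
def ell (τ η x : ℂ) : ℂ := θf τ (2*η*x)

/-- Elliptic shifted factorial [x]_k. -/
def ellFac (τ η x : ℂ) (k : ℕ) : ℂ := ∏ j ∈ Finset.range k, ell τ η (x + j)


open scoped Topology
/-- first coordinate of the theta vector -/
def thA (τ x : ℂ) : ℂ := jacobiTheta₂ (2*x) (2*τ)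
/-- second coordinate of the theta vector -/
def thB (τ x : ℂ) : ℂ := cexp (cπ * I * τ / 2 + 2 * cπ * I * x) * jacobiTheta₂ (2*x + τ) (2*τ)

lemma thf_eq (τ x : ℂ) :
    θf τ x = I * cexp (cπ * I * τ / 4 - cπ * I * x) * jacobiTheta₂ (x - τ/2 + 1/2) τ := by
  unfold θf jacobiTheta₂
  rw [mul_assoc I (cexp _), ← tsum_mul_left (a := cexp (cπ * I * τ / 4 - cπ * I * x))]
  congr 1
  refine tsum_congr fun n => ?_
  have h1 : ((-1 : ℂ)) ^ n = cexp (n * (Real.pi * I)) := by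
    rw [Complex.exp_int_mul, Complex.exp_pi_mul_I]
  rw [h1, jacobiTheta₂_term, ← Complex.exp_add, ← Complex.exp_add]
  congr 1
  simp only [cπ]
  ring

lemma th_inj1 : Function.Injective (fun p : ℤ × ℤ => (p.1 + p.2 + 1, p.1 - p.2)) := by
  rintro ⟨a, b⟩ ⟨c, d⟩ h
  simp only [Prod.mk.injEq] at h ⊢
  omega

lemma th_inj2 : Function.Injective (fun p : ℤ × ℤ => (p.1 + p.2 + 1, p.1 - p.2 + 1)) := by
  rintro ⟨a, b⟩ ⟨c, d⟩ h
  simp only [Prod.mk.injEq] at h ⊢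
  omega

lemma th_compl : IsCompl (Set.range (fun p : ℤ × ℤ => (p.1 + p.2 + 1, p.1 - p.2)))
    (Set.range (fun p : ℤ × ℤ => (p.1 + p.2 + 1, p.1 - p.2 + 1))) := by
  constructor
  · rw [Set.disjoint_left]
    rintro _ ⟨⟨a, b⟩, rfl⟩ ⟨⟨c, d⟩, h⟩
    simp only [Prod.mk.injEq] at h
    omega
  · rw [codisjoint_iff]
    simp only [Set.sup_eq_union, Set.top_eq_univ]
    refine Set.eq_univ_of_forall ?_
    rintro ⟨n, m⟩
    rcases Int.emod_two_eq_zero_or_one (n + m) with h | h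
    · right
      refine ⟨((n + m) / 2 - 1, (n - m) / 2), ?_⟩
      simp only [Prod.mk.injEq]
      omega
    · left
      refine ⟨((n + m) / 2, (n - m) / 2), ?_⟩
      simp only [Prod.mk.injEq]
      omega

lemma th_hasSum_mul {τ : ℂ} (hτ : 0 < τ.im) (z w : ℂ) :
    HasSum (fun p : ℤ × ℤ => jacobiTheta₂_term p.1 z τ * jacobiTheta₂_term p.2 w τ)
      (jacobiTheta₂ z τ * jacobiTheta₂ w τ) := by
  have h1 := ((summable_jacobiTheta₂_term_iff z τ).mpr hτ).norm
  have h2 := ((summable_jacobiTheta₂_term_iff w τ).mpr hτ).norm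
  have := (summable_mul_of_summable_norm h1 h2).hasSum
  rwa [← tsum_mul_tsum_of_summable_norm h1 h2] at this

set_option maxHeartbeats 1000000 in
lemma thf_mul {τ : ℂ} (hτ : 0 < τ.im) (x z : ℂ) :
    θf τ (x + z) * θf τ (x - z) = thA τ x * thB τ z - thB τ x * thA τ z := by
  have h2τ : 0 < (2 * τ).im := by simpa using hτ
  have H1 := th_hasSum_mul h2τ (2*x) (2*z+τ)
  have H2 := th_hasSum_mul h2τ (2*x+τ) (2*z)
  have H := (th_hasSum_mul hτ (x + z - τ/2 + 1/2) (x - z - τ/2 + 1/2)).mul_left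
    (-cexp (cπ * I * τ / 2 - 2 * cπ * I * x))
  have K1 := H1.mul_left (cexp (cπ * I * τ / 2 + 2 * cπ * I * z))
  have K2 := H2.mul_left (-cexp (cπ * I * τ / 2 + 2 * cπ * I * x))
  set f : ℤ × ℤ → ℂ := fun p => -cexp (cπ * I * τ / 2 - 2 * cπ * I * x) *
    (jacobiTheta₂_term p.1 (x + z - τ/2 + 1/2) τ * jacobiTheta₂_term p.2 (x - z - τ/2 + 1/2) τ)
    with hf
  have e1 : f ∘ (fun p : ℤ × ℤ => (p.1 + p.2 + 1, p.1 - p.2)) =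
      fun p : ℤ × ℤ => cexp (cπ * I * τ / 2 + 2 * cπ * I * z) *
        (jacobiTheta₂_term p.1 (2*x) (2*τ) * jacobiTheta₂_term p.2 (2*z+τ) (2*τ)) := by
    funext p
    simp only [hf, Function.comp, jacobiTheta₂_term]
    have h0 : (-1 : ℂ) = cexp (Real.pi * I) := Complex.exp_pi_mul_I.symm
    rw [neg_eq_neg_one_mul, h0]
    simp only [← Complex.exp_add]
    rw [Complex.exp_eq_exp_iff_exists_int]
    refine ⟨p.1 + 1, ?_⟩
    simp only [cπ]
    push_cast
    ring
  have e2 : f ∘ (fun p : ℤ × ℤ => (p.1 + p.2 + 1, p.1 - p.2 + 1)) =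
      fun p : ℤ × ℤ => -cexp (cπ * I * τ / 2 + 2 * cπ * I * x) *
        (jacobiTheta₂_term p.1 (2*x+τ) (2*τ) * jacobiTheta₂_term p.2 (2*z) (2*τ)) := by
    funext p
    simp only [hf, Function.comp, jacobiTheta₂_term, neg_mul]
    congr 1
    simp only [← Complex.exp_add]
    rw [Complex.exp_eq_exp_iff_exists_int]
    refine ⟨p.1 + 1, ?_⟩
    simp only [cπ]
    push_cast
    ring
  have M1 := (th_inj1.hasSum_range_iff (f := f)).mpr (by rw [e1]; exact K1)
  have M2 := (th_inj2.hasSum_range_iff (f := f)).mpr (by rw [e2]; exact K2)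
  have M := HasSum.add_isCompl (f := f) th_compl M1 M2
  have := H.unique M
  rw [thf_eq, thf_eq]
  have e3 : I * cexp (cπ * I * τ / 4 - cπ * I * (x + z)) * jacobiTheta₂ (x + z - τ / 2 + 1 / 2) τ *
      (I * cexp (cπ * I * τ / 4 - cπ * I * (x - z)) * jacobiTheta₂ (x - z - τ / 2 + 1 / 2) τ) =
      -cexp (cπ * I * τ / 2 - 2 * cπ * I * x) *
      (jacobiTheta₂ (x + z - τ/2 + 1/2) τ * jacobiTheta₂ (x - z - τ/2 + 1/2) τ) := by
    have : cexp (cπ * I * τ / 2 - 2 * cπ * I * x) = cexp (cπ * I * τ / 4 - cπ * I * (x + z)) *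
      cexp (cπ * I * τ / 4 - cπ * I * (x - z)) := by
      rw [← Complex.exp_add]; congr 1; ring
    rw [this]
    linear_combination (cexp (cπ * I * τ / 4 - cπ * I * (x + z)) *
      cexp (cπ * I * τ / 4 - cπ * I * (x - z)) *
      (jacobiTheta₂ (x + z - τ/2 + 1/2) τ * jacobiTheta₂ (x - z - τ/2 + 1/2) τ)) * Complex.I_mul_I
  rw [e3, this, thA, thB, thA, thB]
  ring

lemma thA_diff {τ : ℂ} (hτ : 0 < τ.im) : Differentiable ℂ (thA τ) := by
  have h2τ : 0 < (2 * τ).im := by simpa using hτ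
  intro x
  exact (differentiableAt_jacobiTheta₂_fst (2*x) h2τ).comp (f := fun x : ℂ => 2 * x) x (by fun_prop)

lemma thB_diff {τ : ℂ} (hτ : 0 < τ.im) : Differentiable ℂ (thB τ) := by
  have h2τ : 0 < (2 * τ).im := by simpa using hτ
  intro x
  have := (differentiableAt_jacobiTheta₂_fst (2*x+τ) h2τ).comp (f := fun x : ℂ => 2 * x + τ) x
    (by fun_prop)
  exact DifferentiableAt.mul (by fun_prop) this

lemma thA_neg (τ x : ℂ) : thA τ (-x) = thA τ x := by
  unfold thA
  rw [← jacobiTheta₂_neg_left]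
  congr 1
  ring

lemma thA_half (τ x : ℂ) : thA τ (x + 1/2) = thA τ x := by
  unfold thA
  rw [← jacobiTheta₂_add_left (2*x)]
  congr 1
  ring

lemma thB_half (τ x : ℂ) : thB τ (x + 1/2) = - thB τ x := by
  unfold thB
  have : 2 * (x + 1/2) + τ = (2 * x + τ) + 1 := by ring
  rw [this, jacobiTheta₂_add_left]
  have h : cπ * I * τ / 2 + 2 * cπ * I * (x + 1/2) =
    (cπ * I * τ / 2 + 2 * cπ * I * x) + Real.pi * I := by simp only [cπ]; ring
  rw [h, Complex.exp_add, Complex.exp_pi_mul_I]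
  ring

lemma thA_tau (τ x : ℂ) :
    thA τ (x + τ/2) = cexp (-(cπ * I * τ / 2 + 2 * cπ * I * x)) * thB τ x := by
  unfold thA thB
  rw [← mul_assoc, ← Complex.exp_add, neg_add_cancel, Complex.exp_zero, one_mul]
  congr 1
  ring

lemma thB_tau (τ x : ℂ) :
    thB τ (x + τ/2) = cexp (-(cπ * I * τ / 2 + 2 * cπ * I * x)) * thA τ x := by
  unfold thA thB
  have : 2 * (x + τ/2) + τ = 2 * x + 2 * τ := by ring
  rw [this, jacobiTheta₂_add_left', ← mul_assoc, ← Complex.exp_add]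
  congr 2
  simp only [cπ]
  ring

lemma thB_neg (τ x : ℂ) : thB τ (-x) = thB τ x := by
  have h1 := thA_tau τ (x - τ)
  have h2 := thA_tau τ (-x)
  have h3 := thB_tau τ (x - τ/2)
  have h5 := thA_neg τ (x - τ / 2)
  have e1 : -(x - τ/2) = -x + τ/2 := by ring
  have e3 : x - τ/2 + τ/2 = x := by ring
  rw [e1, h2] at h5
  rw [e3, ← h5, ← mul_assoc, ← Complex.exp_add] at h3
  rw [h3]
  have : -(cπ * I * τ / 2 + 2 * cπ * I * (x - τ / 2)) + -(cπ * I * τ / 2 + 2 * cπ * I * -x) = 0 := by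
    ring
  rw [this]; simp


lemma thf_diff {τ : ℂ} (hτ : 0 < τ.im) : Differentiable ℂ (θf τ) := by
  have : θf τ = fun x => I * cexp (cπ * I * τ / 4 - cπ * I * x) * jacobiTheta₂ (x - τ/2 + 1/2) τ := by
    funext x; exact thf_eq τ x
  rw [this]
  intro x
  have := (differentiableAt_jacobiTheta₂_fst (x - τ/2 + 1/2) hτ).comp
    (f := fun x : ℂ => x - τ/2 + 1/2) x (by fun_prop)
  exact DifferentiableAt.mul (by fun_prop) this

lemma thf_odd {τ : ℂ} (hτ : 0 < τ.im) (hne : ∃ w, θf τ w ≠ 0) (y : ℂ) : θf τ (-y) = - θf τ y := by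
  obtain ⟨w, hw⟩ := hne
  have h1 := thf_mul hτ ((w+y)/2) ((w-y)/2)
  have h2 := thf_mul hτ ((w-y)/2) ((w+y)/2)
  rw [show (w+y)/2 + (w-y)/2 = w by ring, show (w+y)/2 - (w-y)/2 = y by ring] at h1
  rw [show (w-y)/2 + (w+y)/2 = w by ring, show (w-y)/2 - (w+y)/2 = -y by ring] at h2
  apply mul_left_cancel₀ hw
  linear_combination h1 + h2

lemma th_vec_ne {τ : ℂ} (hτ : 0 < τ.im) (hne : ∃ w, θf τ w ≠ 0) (x : ℂ) (hA : thA τ x = 0) :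
    thB τ x ≠ 0 := by
  intro hB
  obtain ⟨w, hw⟩ := hne
  have hprod : ∀ z, θf τ (x + z) * θf τ (x - z) = 0 := by
    intro z; rw [thf_mul hτ, hA, hB]; ring
  have hd := thf_diff hτ
  have h1 : ∀ᶠ y in 𝓝 (2*x-w), θf τ y = 0 := by
    have hc : Filter.Tendsto (fun y => θf τ (2*x - y)) (𝓝 (2*x-w)) (𝓝 (θf τ w)) := by
      have : ContinuousAt (fun y => θf τ (2*x - y)) (2*x-w) :=
        (hd.continuous.comp (continuous_const.sub continuous_id)).continuousAt
      have h := this.tendsto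
      rwa [show 2*x-(2*x-w) = w by ring] at h
    filter_upwards [hc.eventually_ne hw] with y hy
    have := hprod (x - y)
    rw [show x + (x - y) = 2*x - y by ring, show x - (x - y) = y by ring] at this
    exact (mul_eq_zero.mp this).resolve_left hy
  have han : AnalyticOnNhd ℂ (θf τ) Set.univ := fun z _ => hd.analyticAt z
  have h2 : ∀ z, θf τ z = 0 := by
    intro z
    have := han.eqOn_zero_of_preconnected_of_eventuallyEq_zero isPreconnected_univ
      (Set.mem_univ (2*x-w)) h1
    exact this (Set.mem_univ z)
  exact hw (h2 w)

/-- A continuous function with bi-periodic norm is bounded. -/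
lemma bdd_of_periodic {t : ℝ} (ht : 0 < t) (h : ℂ → ℂ) (hc : Continuous h)
    (h1 : ∀ x, ‖h (x + 1/2)‖ = ‖h x‖) (h2 : ∀ x, ‖h (x + t * I / 2)‖ = ‖h x‖) :
    Bornology.IsBounded (Set.range h) := by
  have p1 : Function.Periodic (fun x => ‖h x‖) (1/2 : ℂ) := h1
  have p2 : Function.Periodic (fun x => ‖h x‖) (t * I / 2 : ℂ) := h2
  have hK : IsCompact ((fun p : ℝ × ℝ => (p.1 : ℂ) * (1/2) + p.2 * (t * I / 2)) ''
      (Set.Icc 0 1 ×ˢ Set.Icc 0 1)) :=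
    (isCompact_Icc.prod isCompact_Icc).image (by fun_prop)
  obtain ⟨C, hC⟩ := hK.exists_bound_of_continuousOn hc.continuousOn
  refine (Metric.isBounded_closedBall (x := (0:ℂ)) (r := C)).subset ?_
  rintro _ ⟨x, rfl⟩
  rw [mem_closedBall_zero_iff]
  have q1 := p1.int_mul (-⌊2 * x.re⌋)
  have q2 := p2.int_mul (-⌊2 * x.im / t⌋)
  have e := q1 (x + ((-⌊2 * x.im / t⌋ : ℤ) : ℂ) * (t * I / 2))
  have e' := q2 x
  simp only at e e'
  rw [← e', ← e]
  apply hC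
  refine ⟨(Int.fract (2 * x.re), Int.fract (2 * x.im / t)), ⟨⟨Int.fract_nonneg _, (Int.fract_lt_one _).le⟩,
    ⟨Int.fract_nonneg _, (Int.fract_lt_one _).le⟩⟩, ?_⟩
  have ht' : (t : ℂ) ≠ 0 := by exact_mod_cast ht.ne'
  have hx := Complex.re_add_im x
  simp only [Int.fract]
  push_cast
  field_simp
  linear_combination 2 * hx

lemma thf_zero {t : ℝ} (ht : 0 < t) {τ : ℂ} (hτ : τ = t * I) (hne : ∃ w, θf τ w ≠ 0)
    (r α : ℝ) (h0 : θf τ (r + α * τ) = 0) : (∃ n : ℤ, r = n) ∧ (∃ n : ℤ, α = n) := by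
  have him : 0 < τ.im := by rw [hτ]; simpa using ht
  set z0 : ℂ := r + α * τ with hz0
  have hcross : ∀ x, thA τ (x + z0) * thB τ x = thB τ (x + z0) * thA τ x := by
    intro x
    have := thf_mul him (x + z0) (-x)
    rw [show x + z0 + -x = z0 by ring, h0, thA_neg, thB_neg] at this
    linear_combination -this
  have hv := th_vec_ne him hne
  have dA := thA_diff him
  have dB := thB_diff him
  classical
  let g : ℂ → ℂ := fun x => if thA τ x = 0 then thB τ (x + z0) / thB τ x
    else thA τ (x + z0) / thA τ x
  have gA : ∀ x, thA τ (x + z0) = g x * thA τ x := by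
    intro x
    by_cases h : thA τ x = 0
    · have hB := hv x h
      have := hcross x
      rw [h, mul_zero] at this
      rw [h, mul_zero]
      exact (mul_eq_zero.mp this).resolve_right hB
    · simp only [g, if_neg h]; field_simp
  have gB : ∀ x, thB τ (x + z0) = g x * thB τ x := by
    intro x
    by_cases h : thA τ x = 0
    · have hB := hv x h
      simp only [g, if_pos h]; field_simp
    · have := hcross x
      simp only [g, if_neg h]; field_simp
      linear_combination -this
  have guniq : ∀ x y, thA τ (x + z0) = y * thA τ x → thB τ (x + z0) = y * thB τ x → g x = y := by
    intro x y hA hB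
    by_cases h : thA τ x = 0
    · exact mul_right_cancel₀ (hv x h) ((gB x).symm.trans hB)
    · exact mul_right_cancel₀ h ((gA x).symm.trans hA)
  have gd : Differentiable ℂ g := by
    intro x
    by_cases h : thA τ x = 0
    · have hB := hv x h
      have : (fun y => thB τ (y + z0) / thB τ y) =ᶠ[𝓝 x] g := by
        filter_upwards [dB.continuous.continuousAt.eventually_ne hB] with y hy
        rw [gB y]; field_simp
      refine DifferentiableAt.congr_of_eventuallyEq ?_ this.symm
      exact DifferentiableAt.div ((dB _).comp (f := fun y => y + z0) x (by fun_prop)) (dB x) hB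
    · have : (fun y => thA τ (y + z0) / thA τ y) =ᶠ[𝓝 x] g := by
        filter_upwards [dA.continuous.continuousAt.eventually_ne h] with y hy
        rw [gA y]; field_simp
      refine DifferentiableAt.congr_of_eventuallyEq ?_ this.symm
      exact DifferentiableAt.div ((dA _).comp (f := fun y => y + z0) x (by fun_prop)) (dA x) h
  have g1 : ∀ x, g (x + 1/2) = g x := by
    intro x
    apply guniq
    · rw [show x + 1/2 + z0 = x + z0 + 1/2 by ring, thA_half, thA_half]; exact gA x
    · rw [show x + 1/2 + z0 = x + z0 + 1/2 by ring, thB_half, thB_half, gB x]; ring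
  have g2 : ∀ x, g (x + τ/2) = cexp (-(2 * cπ * I * z0)) * g x := by
    intro x
    have he : cexp (-(cπ * I * τ / 2 + 2 * cπ * I * (x + z0))) =
        cexp (-(2 * cπ * I * z0)) * cexp (-(cπ * I * τ / 2 + 2 * cπ * I * x)) := by
      rw [← Complex.exp_add]; congr 1; ring
    apply guniq
    · rw [show x + τ/2 + z0 = x + z0 + τ/2 by ring, thA_tau, thA_tau, gB x, he]; ring
    · rw [show x + τ/2 + z0 = x + z0 + τ/2 by ring, thB_tau, thB_tau, gA x, he]; ring
  let h : ℂ → ℂ := fun x => g x * cexp (4 * cπ * I * α * x)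
  have hd : Differentiable ℂ h := gd.mul (by fun_prop)
  have hh1 : ∀ x, h (x + 1/2) = cexp ((2 * Real.pi * α : ℝ) * I) * h x := by
    intro x
    simp only [h]
    rw [g1, show 4 * cπ * I * α * (x + 1/2) = 4 * cπ * I * α * x + (2 * Real.pi * α : ℝ) * I by
      simp only [cπ]; push_cast; ring, Complex.exp_add]
    ring
  have hh2 : ∀ x, h (x + t * I / 2) = cexp ((-(2 * Real.pi * r) : ℝ) * I) * h x := by
    intro x
    simp only [h]
    rw [← hτ, g2, mul_comm _ (g x), mul_assoc, ← Complex.exp_add, mul_left_comm, ← Complex.exp_add]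
    congr 2
    simp only [hz0, cπ]
    push_cast
    ring
  have hb := bdd_of_periodic ht h hd.continuous
    (fun x => by rw [hh1, norm_mul, Complex.norm_exp_ofReal_mul_I, one_mul])
    (fun x => by rw [hh2, norm_mul, Complex.norm_exp_ofReal_mul_I, one_mul])
  have hconst := fun x y => hd.apply_eq_apply_of_bounded hb x y
  have hnz : h 0 ≠ 0 := by
    intro hz
    have hg0 : g 0 = 0 := by
      simpa [h] using hz
    have e1 := gA 0
    have e2 := gB 0
    rw [hg0, zero_mul] at e1 e2
    exact hv _ e1 e2
  have key : ∀ s : ℝ, cexp ((2 * Real.pi * s : ℝ) * I) = 1 → ∃ n : ℤ, s = n := by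
    intro s hs
    rw [Complex.exp_eq_one_iff] at hs
    obtain ⟨n, hn⟩ := hs
    refine ⟨n, ?_⟩
    have hpi : (Real.pi : ℂ) ≠ 0 := by exact_mod_cast Real.pi_ne_zero
    have : (s : ℂ) = n := by
      have h3 : (2 * Real.pi * I : ℂ) ≠ 0 := by simp [hpi]
      apply mul_left_cancel₀ h3
      push_cast at hn
      linear_combination hn
    exact_mod_cast this
  constructor
  · have e := hh2 0
    rw [hconst _ 0] at e
    have : cexp ((-(2 * Real.pi * r) : ℝ) * I) = 1 := by
      apply mul_right_cancel₀ hnz; rw [← e, one_mul]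
    obtain ⟨n, hn⟩ := key (-r) (by rw [← this]; congr 1; push_cast; ring)
    exact ⟨-n, by push_cast; linarith⟩
  · have e := hh1 0
    rw [hconst _ 0] at e
    have : cexp ((2 * Real.pi * α : ℝ) * I) = 1 := by
      apply mul_right_cancel₀ hnz; rw [← e, one_mul]
    exact key α this

lemma thf_eta_ne {t : ℝ} (ht : 0 < t) {τ : ℂ} (hτ : τ = t * I) (hne : ∃ w, θf τ w ≠ 0)
    (N : ℕ) (η : ℂ)
    (hη : (∃ r : ℝ, η = (r : ℂ) ∧ |r| < 1 / (2 * (N + 1))) ∨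
          (∃ s : ℝ, η = (s : ℂ) * I ∧ |s| < t / (2 * (N + 1))))
    (hη0 : η ≠ 0) (j : ℕ) (hj : j < N) : θf τ ((j + 1) * (2 * η)) ≠ 0 := by
  have key : ∀ s : ℝ, |s| < 1 / (2 * (N + 1)) → s ≠ 0 → ∀ n : ℤ, ((j:ℝ)+1) * (2 * s) ≠ n := by
    intro s hs hs0 n hn
    have hN : (0:ℝ) < 2 * (N + 1) := by positivity
    rw [lt_div_iff₀ hN] at hs
    have hjN : (j:ℝ) + 1 ≤ N := by exact_mod_cast hj
    have h1 : |(n:ℝ)| < 1 := by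
      rw [← hn, abs_mul, abs_mul, abs_of_pos (by positivity : (0:ℝ) < j + 1), abs_two]
      nlinarith [abs_nonneg s]
    have h2 : n = 0 := by
      have : |n| < 1 := by exact_mod_cast h1
      exact Int.abs_lt_one_iff.mp this
    rw [h2, Int.cast_zero] at hn
    have : (j:ℝ) + 1 ≠ 0 := by positivity
    simp [this, hs0] at hn
  intro h0
  rcases hη with ⟨r, hr, hlt⟩ | ⟨s, hs, hlt⟩
  · obtain ⟨⟨n, hn⟩, -⟩ := thf_zero ht hτ hne ((j+1) * (2*r)) 0 (by rw [← h0, hr]; push_cast; simp)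
    exact key r hlt (by rintro rfl; simp at hr; exact hη0 hr) n hn
  · have ht' : (t : ℂ) ≠ 0 := by exact_mod_cast ht.ne'
    obtain ⟨-, ⟨n, hn⟩⟩ := thf_zero ht hτ hne 0 ((j+1) * (2*(s/t)))
      (by rw [← h0, hs, hτ]; congr 1; push_cast; field_simp; ring)
    refine key (s/t) ?_ ?_ n hn
    · rw [abs_div, abs_of_pos ht, div_lt_iff₀ ht]
      calc |s| < _ := hlt
        _ = _ := by ring
    · intro h
      rcases div_eq_zero_iff.mp h with h | h
      · rw [h] at hs; simp at hs; exact hη0 hs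
      · exact ht.ne' h


/-- Shifted product. -/
def Qp (T : ℂ → ℂ) (s x : ℂ) (n : ℕ) : ℂ := ∏ j ∈ Finset.range n, T (x + j * s)

lemma Qp_zero (T : ℂ → ℂ) (s x : ℂ) : Qp T s x 0 = 1 := by simp [Qp]

lemma Qp_succ (T : ℂ → ℂ) (s x : ℂ) (n : ℕ) : Qp T s x (n+1) = Qp T s x n * T (x + n * s) := by
  simp [Qp, Finset.prod_range_succ]

lemma Qp_succ' (T : ℂ → ℂ) (s x : ℂ) (n : ℕ) : Qp T s x (n+1) = T x * Qp T s (x + s) n := by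
  simp only [Qp, Finset.prod_range_succ']
  rw [mul_comm]
  congr 1
  · simp
  · refine Finset.prod_congr rfl fun j _ => ?_
    congr 1; push_cast; ring

lemma Qp_ne (T : ℂ → ℂ) (s x : ℂ) (n : ℕ) (h : ∀ j < n, T (x + j * s) ≠ 0) : Qp T s x n ≠ 0 := by
  rw [Qp, Finset.prod_ne_zero_iff]
  intro j hj
  exact h j (Finset.mem_range.mp hj)

/-- The coefficient in the kernel expansion. -/
def bet (T : ℂ → ℂ) (s a b : ℂ) (k m : ℕ) : ℂ :=
  (-1) ^ m * Qp T s s (k + m) / (Qp T s s k * Qp T s s m * Qp T s (a + b) (k + m) *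
    Qp T s (a - b - m * s) k * Qp T s (a - b + (k - m + 1) * s) m)

/-- The dual basis function. -/
def Gf (T : ℂ → ℂ) (s a b c : ℂ) (k m : ℕ) : ℂ :=
  Qp T s (c - b) k * Qp T s (c - a) m * Qp T s (c + b + m * s) k * Qp T s (c + a + k * s) m

/-- The basis function. -/
def Ef (T : ℂ → ℂ) (s a b x : ℂ) (k m : ℕ) : ℂ :=
  (∏ j ∈ Finset.range k, (T (a + j * s + x) * T (a + j * s - x))) *
  (∏ j ∈ Finset.range m, (T (b + j * s + x) * T (b + j * s - x)))

/-- three-term relation -/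
def ThreeTerm (T : ℂ → ℂ) : Prop := ∀ x y z w, T (x+y) * T (x-y) * (T (z+w) * T (z-w)) =
  T (x+w) * T (x-w) * (T (z+y) * T (z-y)) - T (x+z) * T (x-z) * (T (w+y) * T (w-y))

/-- nonvanishing conditions -/
structure NV (T : ℂ → ℂ) (s a b : ℂ) (N : ℕ) : Prop where
  h1 : ∀ j < N, T (s + j * s) ≠ 0
  h2 : ∀ j < N, T (a + b + j * s) ≠ 0
  h3 : ∀ i : ℤ, i.natAbs < N → T (a - b + i * s) ≠ 0

lemma NV.mono {T : ℂ → ℂ} {s a b : ℂ} {N M : ℕ} (h : NV T s a b N) (hM : M ≤ N) : NV T s a b M :=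
  ⟨fun j hj => h.h1 j (by omega), fun j hj => h.h2 j (by omega), fun i hi => h.h3 i (by omega)⟩

lemma rec_field (sg Qn Qk Qm Qab P1 P2 tn1 tk tm tab d1 d2 d3 cb ca u1 u2 u3 u4 g : ℂ)
    (hQk : Qk ≠ 0) (hQm : Qm ≠ 0) (hQab : Qab ≠ 0) (hP1 : P1 ≠ 0) (hP2 : P2 ≠ 0)
    (htk : tk ≠ 0) (htm : tm ≠ 0) (htab : tab ≠ 0) (hd1 : d1 ≠ 0) (hd2 : d2 ≠ 0) (hd3 : d3 ≠ 0)
    (H : tn1 * d2 * (cb * ca) = u1 * u2 * tk * d3 + u3 * u4 * tm * d1) :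
    (sg * (-1)) * (Qn * tn1) / (Qk * tk * (Qm * tm) * (Qab * tab) * (d1 * P1) * (P2 * d3)) *
      (g * (cb * ca)) =
    (sg * (-1)) * Qn / (Qk * (Qm * tm) * Qab * (d1 * P1) * (d2 * P2)) * (g * (u1 * u2)) / tab -
    sg * Qn / (Qk * tk * Qm * Qab * (P1 * d2) * (P2 * d3)) * (g * (u3 * u4)) / tab := by
  field_simp
  linear_combination (-(sg*Qn*g)) * H

lemma rec_main {T : ℂ → ℂ} (h3 : ThreeTerm T) (hodd : ∀ x, T (-x) = - T x) {s a b : ℂ} (c : ℂ)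
    (k m : ℕ) (hN : NV T s a b (k + m + 2)) :
    bet T s a b (k+1) (m+1) * Gf T s a b c (k+1) (m+1) =
    bet T s a b k (m+1) * Gf T s a b c k (m+1) *
      ((T (c + (k+m+1) * s + (b + (m+1) * s)) * T (c + (k+m+1) * s - (b + (m+1) * s))) /
        (T (a + k * s + (b + (m+1) * s)) * T (a + k * s - (b + (m+1) * s)))) -
    bet T s a b (k+1) m * Gf T s a b c (k+1) m *
      ((T (c + (k+m+1) * s + (a + (k+1) * s)) * T (c + (k+m+1) * s - (a + (k+1) * s))) /
        (T (a + (k+1) * s + (b + m * s)) * T (a + (k+1) * s - (b + m * s)))) := by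
  have hQk : Qp T s s k ≠ 0 := Qp_ne _ _ _ _ fun j hj => hN.h1 j (by omega)
  have hQm : Qp T s s m ≠ 0 := Qp_ne _ _ _ _ fun j hj => hN.h1 j (by omega)
  have hQab : Qp T s (a+b) (k+m+1) ≠ 0 := Qp_ne _ _ _ _ fun j hj => hN.h2 j (by omega)
  have hP1 : Qp T s (a - b - m * s) k ≠ 0 := Qp_ne _ _ _ _ fun j hj => by
    have := hN.h3 (j - m) (by omega)
    convert this using 2; push_cast; ring
  have hP2 : Qp T s (a - b + (k - m + 1) * s) m ≠ 0 := Qp_ne _ _ _ _ fun j hj => by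
    have := hN.h3 (k - m + 1 + j) (by omega)
    convert this using 2; push_cast; ring
  have htk := hN.h1 k (by omega)
  have htm := hN.h1 m (by omega)
  have htab := hN.h2 (k+m+1) (by omega)
  have hd1 : T (a - b - (m+1) * s) ≠ 0 := by
    have := hN.h3 (-(m+1)) (by omega)
    convert this using 2; push_cast; ring
  have hd2 : T (a - b + (k - m) * s) ≠ 0 := by
    have := hN.h3 (k-m) (by omega)
    convert this using 2; push_cast; ring
  have hd3 : T (a - b + (k+1) * s) ≠ 0 := by
    have := hN.h3 (k+1) (by omega)
    convert this using 2; push_cast; ring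
  have hd4 : T (a - b + (k - m - 1) * s) ≠ 0 := by
    have := hN.h3 (k - m - 1) (by omega)
    convert this using 2; push_cast; ring
  have hd5 : T (a - b + (k + 1 - m) * s) ≠ 0 := by
    have := hN.h3 (k + 1 - m) (by omega)
    convert this using 2; push_cast; ring
  have H : T (s + (k+m+1 : ℕ) * s) * T (a - b + (k - m) * s) *
      (T (c + b + (k+m+1) * s) * T (c + a + (k+m+1) * s)) =
      T (c + a + k * s) * T (c + b + (k + 2*m+2) * s) * T (s + k * s) * T (a - b + (k+1) * s) +
      T (c + b + m * s) * T (c + a + (2*k + m+2) * s) * T (s + m * s) * T (a - b - (m+1) * s) := by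
    have := h3 (c + (a+b)/2 + (k+m+1)*s) ((a-b)/2) ((a-b)/2 + (k+1)*s) ((m+1)*s - (a-b)/2)
    have ho := hodd (a - b - (m+1) * s)
    rw [show c + (a+b)/2 + (k+m+1)*s + (a-b)/2 = c + a + (k+m+1)*s by ring,
      show c + (a+b)/2 + (k+m+1)*s - (a-b)/2 = c + b + (k+m+1)*s by ring,
      show (a-b)/2 + (k+1)*s + ((m+1)*s - (a-b)/2) = s + (k+m+1 : ℕ) * s by push_cast; ring,
      show (a-b)/2 + (k+1)*s - ((m+1)*s - (a-b)/2) = a - b + (k-m)*s by ring,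
      show c + (a+b)/2 + (k+m+1)*s + ((m+1)*s - (a-b)/2) = c + b + (k+2*m+2)*s by ring,
      show c + (a+b)/2 + (k+m+1)*s - ((m+1)*s - (a-b)/2) = c + a + k * s by ring,
      show (a-b)/2 + (k+1)*s + (a-b)/2 = a - b + (k+1)*s by ring,
      show (a-b)/2 + (k+1)*s - (a-b)/2 = s + k * s by ring,
      show c + (a+b)/2 + (k+m+1)*s + ((a-b)/2 + (k+1)*s) = c + a + (2*k+m+2)*s by ring,
      show c + (a+b)/2 + (k+m+1)*s - ((a-b)/2 + (k+1)*s) = c + b + m*s by ring,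
      show (m+1)*s - (a-b)/2 + (a-b)/2 = s + m * s by ring,
      show (m+1)*s - (a-b)/2 - (a-b)/2 = -(a - b - (m+1)*s) by ring, ho] at this
    linear_combination this
  have F := rec_field ((-1)^m) (Qp T s s (k+m+1)) (Qp T s s k) (Qp T s s m)
    (Qp T s (a+b) (k+m+1)) _ _ _ _ _ _ _ _ _ _ _ _ _ _ _
    (Qp T s (c-b) k * T (c - b + k * s) * (Qp T s (c-a) m * T (c - a + m * s)) *
      Qp T s (c + b + (m+1) * s) k * Qp T s (c + a + (k+1) * s) m)
    hQk hQm hQab hP1 hP2 htk htm htab hd1 hd2 hd3 H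
  have e1 : Qp T s (a - b - (m+1) * s) (k+1) = T (a - b - (m+1)*s) * Qp T s (a - b - m * s) k := by
    rw [Qp_succ']; congr 2; ring
  have e2 : Qp T s (a - b + (k - m + 1) * s) (m+1) =
      Qp T s (a - b + (k - m + 1) * s) m * T (a - b + (k+1) * s) := by
    rw [Qp_succ]; congr 2; ring
  have e3 : Qp T s (a - b - (m+1) * s) k * T (a - b + (k - m - 1) * s) =
      T (a - b - (m+1)*s) * Qp T s (a - b - m * s) k := by
    rw [← e1, Qp_succ]; congr 2; ring
  have e4 : Qp T s (a - b + (k - m) * s) (m+1) =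
      T (a - b + (k-m) * s) * Qp T s (a - b + (k - m + 1) * s) m := by
    rw [Qp_succ']; congr 2; ring
  have e5 : Qp T s (a - b - m * s) (k+1) = Qp T s (a - b - m * s) k * T (a - b + (k-m) * s) := by
    rw [Qp_succ]; congr 2; ring
  have e6 : T (a - b + (k + 1 - m) * s) * Qp T s (a - b + (k - m + 2) * s) m =
      Qp T s (a - b + (k - m + 1) * s) m * T (a - b + (k+1) * s) := by
    rw [← e2, Qp_succ']; congr 2 <;> ring_nf
  have g1 : Qp T s (c + b + (m+1)*s) (k+1) =
      Qp T s (c + b + (m+1)*s) k * T (c + b + (k+m+1) * s) := by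
    rw [Qp_succ]; congr 2; ring
  have g2 : Qp T s (c + b + m*s) (k+1) = T (c + b + m * s) * Qp T s (c + b + (m+1)*s) k := by
    rw [Qp_succ']; congr 2; ring
  have g3 : Qp T s (c + a + (k+1)*s) (m+1) =
      Qp T s (c + a + (k+1)*s) m * T (c + a + (k+m+1) * s) := by
    rw [Qp_succ]; congr 2; ring
  have g4 : Qp T s (c + a + k*s) (m+1) = T (c + a + k * s) * Qp T s (c + a + (k+1)*s) m := by
    rw [Qp_succ']; congr 2; ring
  -- identify the three terms
  have t1 : bet T s a b (k+1) (m+1) * Gf T s a b c (k+1) (m+1) =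
      ((-1)^m * (-1)) * (Qp T s s (k+m+1) * T (s + (k+m+1 : ℕ) * s)) /
      (Qp T s s k * T (s + k * s) * (Qp T s s m * T (s + m * s)) *
        (Qp T s (a+b) (k+m+1) * T (a + b + (k+m+1 : ℕ) * s)) *
        (T (a - b - (m+1)*s) * Qp T s (a - b - m * s) k) *
        (Qp T s (a - b + (k - m + 1) * s) m * T (a - b + (k+1) * s))) *
      ((Qp T s (c-b) k * T (c - b + k * s) * (Qp T s (c-a) m * T (c - a + m * s)) *
      Qp T s (c + b + (m+1) * s) k * Qp T s (c + a + (k+1) * s) m) *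
      (T (c + b + (k+m+1) * s) * T (c + a + (k+m+1) * s))) := by
    unfold bet Gf
    rw [show k + 1 + (m + 1) = (k + m + 1) + 1 by ring]
    push_cast
    rw [show ((k:ℂ) + 1 - (m + 1) + 1) = k - m + 1 by ring, e1, e2, g1, g3,
      Qp_succ T s s, Qp_succ T s s k, Qp_succ T s s m, Qp_succ T s (a+b), Qp_succ T s (c-b),
      Qp_succ T s (c-a), pow_succ]
    push_cast
    ring
  have t2 : bet T s a b k (m+1) * Gf T s a b c k (m+1) *
      ((T (c + (k+m+1) * s + (b + (m+1) * s)) * T (c + (k+m+1) * s - (b + (m+1) * s))) /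
        (T (a + k * s + (b + (m+1) * s)) * T (a + k * s - (b + (m+1) * s)))) =
      ((-1)^m * (-1)) * Qp T s s (k+m+1) / (Qp T s s k * (Qp T s s m * T (s + m * s)) *
        Qp T s (a+b) (k+m+1) * (T (a - b - (m+1)*s) * Qp T s (a - b - m * s) k) *
        (T (a - b + (k - m) * s) * Qp T s (a - b + (k - m + 1) * s) m)) *
      ((Qp T s (c-b) k * T (c - b + k * s) * (Qp T s (c-a) m * T (c - a + m * s)) *
      Qp T s (c + b + (m+1) * s) k * Qp T s (c + a + (k+1) * s) m) *
      (T (c + a + k * s) * T (c + b + (k+2*m+2) * s))) / T (a + b + (k+m+1 : ℕ) * s) := by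
    unfold bet Gf
    rw [show k + (m + 1) = (k + m + 1) by ring, ← e3]
    push_cast
    rw [show ((k:ℂ) - (m + 1) + 1) = k - m by ring, e4, g4,
      Qp_succ T s s m, Qp_succ T s (c-a), pow_succ,
      show c + (k+m+1) * s + (b + (m+1) * s) = c + b + (k+2*m+2) * s by ring,
      show c + (k+m+1) * s - (b + (m+1) * s) = c - b + k * s by ring,
      show a + k * s + (b + (m+1) * s) = a + b + (k + m + 1) * s by ring,
      show a + k * s - (b + (m+1) * s) = a - b + (k - m - 1) * s by ring]
    simp only [div_eq_mul_inv, mul_inv]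
    ring
  have t3 : bet T s a b (k+1) m * Gf T s a b c (k+1) m *
      ((T (c + (k+m+1) * s + (a + (k+1) * s)) * T (c + (k+m+1) * s - (a + (k+1) * s))) /
        (T (a + (k+1) * s + (b + m * s)) * T (a + (k+1) * s - (b + m * s)))) =
      (-1)^m * Qp T s s (k+m+1) / (Qp T s s k * T (s + k * s) * Qp T s s m *
        Qp T s (a+b) (k+m+1) * (Qp T s (a - b - m * s) k * T (a - b + (k - m) * s)) *
        (Qp T s (a - b + (k - m + 1) * s) m * T (a - b + (k+1) * s))) *
      ((Qp T s (c-b) k * T (c - b + k * s) * (Qp T s (c-a) m * T (c - a + m * s)) *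
      Qp T s (c + b + (m+1) * s) k * Qp T s (c + a + (k+1) * s) m) *
      (T (c + b + m * s) * T (c + a + (2*k+m+2) * s))) / T (a + b + (k+m+1 : ℕ) * s) := by
    unfold bet Gf
    rw [show k + 1 + m = (k + m + 1) by ring, ← e6]
    push_cast
    rw [show ((k:ℂ) + 1 - m + 1) = k - m + 2 by ring, e5, g2,
      Qp_succ T s s k, Qp_succ T s (c-b),
      show c + (k+m+1) * s + (a + (k+1) * s) = c + a + (2*k+m+2) * s by ring,
      show c + (k+m+1) * s - (a + (k+1) * s) = c - a + m * s by ring,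
      show a + (k+1) * s + (b + m * s) = a + b + (k + m + 1) * s by ring,
      show a + (k+1) * s - (b + m * s) = a - b + (k + 1 - m) * s by ring]
    simp only [div_eq_mul_inv, mul_inv]
    ring
  rw [t1, t2, t3]
  exact F

lemma rec_left {T : ℂ → ℂ} {s a b : ℂ} (c : ℂ) (k : ℕ) (hN : NV T s a b (k + 1)) :
    bet T s a b (k+1) 0 * Gf T s a b c (k+1) 0 = bet T s a b k 0 * Gf T s a b c k 0 *
      ((T (c + k * s + b) * T (c + k * s - b)) / (T (a + k * s + b) * T (a + k * s - b))) := by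
  have hQk : Qp T s s k ≠ 0 := Qp_ne _ _ _ _ fun j hj => hN.h1 j (by omega)
  have htk := hN.h1 k (by omega)
  unfold bet Gf
  simp only [Qp_zero, add_zero, Nat.cast_zero, zero_mul, sub_zero, mul_one, pow_zero, one_mul]
  rw [Qp_succ, Qp_succ, Qp_succ, Qp_succ, Qp_succ,
    show c + k * s + b = c + b + k * s by ring, show c + k * s - b = c - b + k * s by ring,
    show a + k * s + b = a + b + k * s by ring, show a + k * s - b = a - b + k * s by ring]
  simp only [div_eq_mul_inv, mul_inv]
  generalize T (s + k * s) = tk at htk ⊢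
  field_simp

lemma rec_right {T : ℂ → ℂ} {s a b : ℂ} (c : ℂ) (m : ℕ) (hN : NV T s a b (m + 1)) :
    bet T s a b 0 (m+1) * Gf T s a b c 0 (m+1) = - (bet T s a b 0 m * Gf T s a b c 0 m *
      ((T (c + m * s + a) * T (c + m * s - a)) / (T (a + (b + m * s)) * T (a - (b + m * s))))) := by
  have hQk : Qp T s s m ≠ 0 := Qp_ne _ _ _ _ fun j hj => hN.h1 j (by omega)
  have htk := hN.h1 m (by omega)
  unfold bet Gf
  simp only [Qp_zero, zero_add, Nat.cast_zero, zero_mul, mul_one, one_mul, add_zero, zero_sub]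
  push_cast
  have e : Qp T s (a - b + (-(m+1) + 1) * s) (m+1) =
      T (a - (b + m * s)) * Qp T s (a - b + (-m + 1) * s) m := by
    rw [Qp_succ']; congr 2 <;> ring
  rw [e, Qp_succ, Qp_succ, Qp_succ, Qp_succ, pow_succ,
    show c + m * s + a = c + a + m * s by ring, show c + m * s - a = c - a + m * s by ring,
    show a + (b + m * s) = a + b + m * s by ring]
  simp only [div_eq_mul_inv, mul_inv]
  generalize T (s + m * s) = tk at htk ⊢
  field_simp


lemma sum_antidiag_split (w u v : ℕ → ℕ → ℂ) (N : ℕ)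
    (h1 : ∀ k m, k + m + 1 = N → w (k+1) (m+1) = u k (m+1) + v (k+1) m)
    (h2 : w (N+1) 0 = u N 0) (h3 : w 0 (N+1) = v 0 N) :
    ∑ p ∈ Finset.HasAntidiagonal.antidiagonal (N+1), w p.1 p.2 =
      ∑ p ∈ Finset.HasAntidiagonal.antidiagonal N, (u p.1 p.2 + v p.1 p.2) := by
  rcases N with _ | M
  · simp [Finset.Nat.antidiagonal_succ, h2, h3]
    ring
  · rw [Finset.sum_add_distrib, Finset.Nat.sum_antidiagonal_succ,
      Finset.Nat.sum_antidiagonal_succ' (n := M) (f := fun p => w (p.1+1) p.2),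
      Finset.Nat.sum_antidiagonal_succ' (n := M) (f := fun p => u p.1 p.2),
      Finset.Nat.sum_antidiagonal_succ (n := M) (f := fun p => v p.1 p.2)]
    simp only
    rw [h2, h3]
    have : ∑ p ∈ Finset.HasAntidiagonal.antidiagonal M, w (p.1+1) (p.2+1) =
        ∑ p ∈ Finset.HasAntidiagonal.antidiagonal M, (u p.1 (p.2+1) + v (p.1+1) p.2) := by
      refine Finset.sum_congr rfl fun p hp => h1 _ _ ?_
      rw [Finset.HasAntidiagonal.mem_antidiagonal] at hp; omega
    rw [this, Finset.sum_add_distrib]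
    ring

lemma kernel_exp {T : ℂ → ℂ} (h3 : ThreeTerm T) (hodd : ∀ x, T (-x) = - T x) {s a b : ℂ} (c x : ℂ)
    (N : ℕ) (hN : NV T s a b N) :
    ∏ j ∈ Finset.range N, (T (c + j * s + x) * T (c + j * s - x)) =
      ∑ p ∈ Finset.HasAntidiagonal.antidiagonal N, bet T s a b p.1 p.2 * Gf T s a b c p.1 p.2 * Ef T s a b x p.1 p.2 := by
  induction N with
  | zero => simp [bet, Gf, Ef, Qp_zero]
  | succ N ih =>
    rw [Finset.prod_range_succ, ih (hN.mono (by omega)), Finset.sum_mul]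
    let D : ℂ → ℂ → ℂ := fun y z => T (y + z) * T (y - z)
    let u : ℕ → ℕ → ℂ := fun k m => bet T s a b k m * Gf T s a b c k m *
      (D (c + N * s) (b + m * s) / D (a + k * s) (b + m * s)) * Ef T s a b x (k+1) m
    let v : ℕ → ℕ → ℂ := fun k m => - (bet T s a b k m * Gf T s a b c k m *
      (D (c + N * s) (a + k * s) / D (a + k * s) (b + m * s)) * Ef T s a b x k (m+1))
    rw [sum_antidiag_split (fun k m => bet T s a b k m * Gf T s a b c k m * Ef T s a b x k m) u v N]
    · refine Finset.sum_congr rfl fun p hp => ?_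
      obtain ⟨k, m⟩ := p
      rw [Finset.HasAntidiagonal.mem_antidiagonal] at hp
      simp only at hp ⊢
      have hD : D (a + k * s) (b + m * s) ≠ 0 := by
        refine mul_ne_zero ?_ ?_
        · have := hN.h2 (k + m) (by omega)
          convert this using 2; push_cast; ring
        · have := hN.h3 (k - m) (by omega)
          convert this using 2; push_cast; ring
      have hE1 : Ef T s a b x (k+1) m = Ef T s a b x k m * D (a + k * s) x := by
        simp only [Ef, Finset.prod_range_succ, D]; ring
      have hE2 : Ef T s a b x k (m+1) = Ef T s a b x k m * D (b + m * s) x := by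
        simp only [Ef, Finset.prod_range_succ, D]; ring
      have key : D (c + N * s) x * D (a + k * s) (b + m * s) =
          D (c + N * s) (b + m * s) * D (a + k * s) x - D (c + N * s) (a + k * s) * D (b + m * s) x :=
        h3 _ _ _ _
      simp only [u, v]
      rw [hE1, hE2]
      have : T (c + N * s + x) * T (c + N * s - x) = D (c + N * s) x := rfl
      rw [this]
      generalize D (a + k * s) (b + m * s) = d0 at hD key ⊢
      generalize D (c + N * s) x = d1 at key ⊢
      generalize D (c + N * s) (b + m * s) = d2 at key ⊢
      generalize D (a + k * s) x = d3 at key ⊢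
      generalize D (c + N * s) (a + k * s) = d4 at key ⊢
      generalize D (b + m * s) x = d5 at key ⊢
      field_simp
      linear_combination (bet T s a b k m * Gf T s a b c k m * Ef T s a b x k m) * key
    · intro k m hkm
      have hr := rec_main h3 hodd c k m (hN.mono (by omega))
      rw [hr]
      simp only [u, v, D, ← hkm]
      push_cast
      ring
    · rw [rec_left c N hN]
      simp [u, D]
    · rw [rec_right c N hN]
      simp [v, D]


lemma thf_threeTerm {τ : ℂ} (hτ : 0 < τ.im) : ThreeTerm (θf τ) := by
  intro x y z w
  rw [thf_mul hτ, thf_mul hτ, thf_mul hτ, thf_mul hτ, thf_mul hτ, thf_mul hτ]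
  ring

lemma ekN_eq (τ η : ℂ) (N k : ℕ) (a b x : ℂ) :
    ekN τ η N k a b x = Ef (θf τ) (2*η) a b x k (N - k) := by
  unfold ekN Ef
  congr 1 <;>
  · refine Finset.prod_congr rfl fun j _ => ?_
    congr 2 <;> ring

lemma thetaSp_powA {τ : ℂ} (hτ : 0 < τ.im) (N : ℕ) : ThetaSp τ N (fun x => thA τ x ^ N) := by
  refine ⟨(thA_diff hτ).pow N, fun x => ?_, fun x => ?_, fun x => ?_⟩
  · simp only
    rw [show x + 1 = x + 1/2 + 1/2 by ring, thA_half, thA_half]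
  · simp only
    rw [show x + τ = x + τ/2 + τ/2 by ring, thA_tau, thB_tau, ← mul_assoc, ← Complex.exp_add,
      mul_pow, ← Complex.exp_nat_mul]
    congr 2
    ring
  · simp only [thA_neg]

lemma thetaSp_powB {τ : ℂ} (hτ : 0 < τ.im) (N : ℕ) : ThetaSp τ N (fun x => thB τ x ^ N) := by
  refine ⟨(thB_diff hτ).pow N, fun x => ?_, fun x => ?_, fun x => ?_⟩
  · simp only
    rw [show x + 1 = x + 1/2 + 1/2 by ring, thB_half, thB_half, neg_neg]
  · simp only
    rw [show x + τ = x + τ/2 + τ/2 by ring, thB_tau, thA_tau, ← mul_assoc, ← Complex.exp_add,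
      mul_pow, ← Complex.exp_nat_mul]
    congr 2
    ring
  · simp only [thB_neg]

lemma basis_ne {τ η : ℂ} (hτ : 0 < τ.im) (hne : ∃ w, θf τ w ≠ 0) {N : ℕ} {a b : ℂ}
    (hb : ∀ h : ℂ → ℂ, ThetaSp τ N h →
      ∃! co : Fin (N + 1) → ℂ, ∀ x, h x = ∑ k : Fin (N + 1), co k * ekN τ η N k a b x) (x : ℂ) :
    ∃ k ≤ N, ekN τ η N k a b x ≠ 0 := by
  by_contra hcon
  push Not at hcon
  have hz : ∀ h : ℂ → ℂ, ThetaSp τ N h → h x = 0 := by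
    intro h hh
    obtain ⟨co, hco, -⟩ := hb h hh
    rw [hco x]
    refine Finset.sum_eq_zero fun k _ => ?_
    rw [hcon k (by omega), mul_zero]
  have hA := hz _ (thetaSp_powA hτ N)
  have hB := hz _ (thetaSp_powB hτ N)
  exact th_vec_ne hτ hne x (by by_contra h; exact pow_ne_zero N h hA)
    (by by_contra h; exact pow_ne_zero N h hB)

lemma basis_NV {τ η : ℂ} (hτ : 0 < τ.im) (hne : ∃ w, θf τ w ≠ 0) {N : ℕ} {a b : ℂ}
    (hs : ∀ j < N, θf τ ((j + 1) * (2 * η)) ≠ 0)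
    (hb : ∀ h : ℂ → ℂ, ThetaSp τ N h →
      ∃! co : Fin (N + 1) → ℂ, ∀ x, h x = ∑ k : Fin (N + 1), co k * ekN τ η N k a b x) :
    NV (θf τ) (2*η) a b N := by
  have hodd := thf_odd hτ hne
  have h0 : θf τ 0 = 0 := by
    have := hodd 0
    rw [neg_zero] at this
    linear_combination this / 2
  have Ha : ∀ j < N, θf τ (b + j * (2*η) + a) * θf τ (b + j * (2*η) - a) ≠ 0 := by
    obtain ⟨k, hk, hne'⟩ := basis_ne hτ hne hb a
    rw [ekN_eq, Ef] at hne'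
    rcases k with _ | k
    · intro j hj
      have := right_ne_zero_of_mul hne'
      rw [Finset.prod_ne_zero_iff] at this
      exact this j (Finset.mem_range.mpr (by omega))
    · exfalso
      have := left_ne_zero_of_mul hne'
      rw [Finset.prod_ne_zero_iff] at this
      apply this 0 (Finset.mem_range.mpr (by omega))
      simp [h0]
  have Hb : ∀ j < N, θf τ (a + j * (2*η) + b) * θf τ (a + j * (2*η) - b) ≠ 0 := by
    obtain ⟨k, hk, hne'⟩ := basis_ne hτ hne hb b
    rw [ekN_eq, Ef] at hne'
    rcases Nat.lt_or_ge k N with hkN | hkN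
    · exfalso
      have := right_ne_zero_of_mul hne'
      rw [Finset.prod_ne_zero_iff] at this
      apply this 0 (Finset.mem_range.mpr (by omega))
      simp [h0]
    · intro j hj
      have := left_ne_zero_of_mul hne'
      rw [Finset.prod_ne_zero_iff] at this
      exact this j (Finset.mem_range.mpr (by omega))
  refine ⟨fun j hj => ?_, fun j hj => ?_, fun i hi => ?_⟩
  · convert hs j hj using 2; ring
  · convert left_ne_zero_of_mul (Ha j hj) using 2; ring
  · rcases Int.natAbs_eq i with h | h
    · convert right_ne_zero_of_mul (Hb i.natAbs hi) using 2
      have : (i : ℂ) = (i.natAbs : ℂ) := by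
        have := congrArg (fun z : ℤ => (z:ℂ)) h
        simpa only [Int.cast_neg, Int.cast_natCast] using this
      rw [this]; ring
    · have h2 := right_ne_zero_of_mul (Ha i.natAbs hi)
      have : (i : ℂ) = -(i.natAbs : ℂ) := by
        have := congrArg (fun z : ℤ => (z:ℂ)) h
        simpa only [Int.cast_neg, Int.cast_natCast] using this
      rw [this, show a - b + -(i.natAbs : ℂ) * (2*η) = -(b + (i.natAbs : ℂ) * (2*η) - a) by ring,
        hodd]
      exact neg_ne_zero.mpr h2

lemma basis_indep {τ η : ℂ} {N : ℕ} {a b : ℂ}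
    (hb : ∀ h : ℂ → ℂ, ThetaSp τ N h →
      ∃! co : Fin (N + 1) → ℂ, ∀ x, h x = ∑ k : Fin (N + 1), co k * ekN τ η N k a b x)
    (co : ℕ → ℂ) (h : ∀ x, ∑ k ∈ Finset.range (N+1), co k * ekN τ η N k a b x = 0)
    (k : ℕ) (hk : k ≤ N) : co k = 0 := by
  have h0 : ThetaSp τ N (fun _ => 0) := by
    refine ⟨by fun_prop, ?_, ?_, ?_⟩ <;> simp
  have hu := (hb _ h0).unique (y₁ := fun k => co k) (y₂ := fun _ => 0)
    (fun x => by
      rw [Fin.sum_univ_eq_sum_range (fun k => co k * ekN τ η N k a b x) (N+1), h x])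
    (fun x => by simp)
  exact congrFun hu ⟨k, by omega⟩

lemma Gf_eq {T : ℂ → ℂ} (hodd : ∀ x, T (-x) = - T x) (η a b u : ℂ) (k m N : ℕ) (h : k + m = N) :
    Gf T (2*η) a b (u + η*(1-N)) k m =
      (-1)^N * Ef T (2*η) (η*(1 - N) - b) (η*(1 - N) - a) u k m := by
  have key : ∀ (b : ℂ) (k m : ℕ), k + m = N → Qp T (2*η) (u + η*(1-N) - b) k *
      Qp T (2*η) (u + η*(1-N) + b + m * (2*η)) k = (-1)^k * ∏ j ∈ Finset.range k,
      (T (η*(1 - N) - b + j * (2*η) + u) * T (η*(1 - N) - b + j * (2*η) - u)) := by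
    intro b k m h
    rw [Finset.prod_mul_distrib]
    have e1 : Qp T (2*η) (u + η*(1-N) - b) k =
        ∏ j ∈ Finset.range k, T (η*(1 - N) - b + j * (2*η) + u) := by
      refine Finset.prod_congr rfl fun j _ => ?_
      congr 1; ring
    have e2 : Qp T (2*η) (u + η*(1-N) + b + m * (2*η)) k =
        (-1)^k * ∏ j ∈ Finset.range k, T (η*(1 - N) - b + j * (2*η) - u) := by
      rw [Qp, ← Finset.prod_range_reflect]
      have : ((-1:ℂ))^k = ∏ j ∈ Finset.range k, (-1 : ℂ) := by simp
      rw [this, ← Finset.prod_mul_distrib]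
      refine Finset.prod_congr rfl fun j hj => ?_
      rw [Finset.mem_range] at hj
      rw [neg_one_mul, ← hodd]
      congr 1
      have : ((k - 1 - j : ℕ) : ℂ) = k - 1 - j := by
        rw [Nat.cast_sub (by omega), Nat.cast_sub (by omega)]; simp
      rw [this, ← h]
      push_cast
      ring
    rw [e1, e2]; ring
  have K1 := key b k m h
  have K2 := key a m k (by omega)
  rw [Gf, Ef]
  have : ((-1:ℂ))^N = (-1)^k * (-1)^m := by rw [← h, pow_add]
  rw [this]
  linear_combination (Qp T (2*η) (u + η*(1-N) - a) m *
      Qp T (2*η) (u + η*(1-N) + a + k * (2*η)) m) * K1 + ((-1)^k * ∏ j ∈ Finset.range k,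
      (T (η*(1 - N) - b + j * (2*η) + u) * T (η*(1 - N) - b + j * (2*η) - u))) * K2

lemma kernel_exp' {τ : ℂ} (hτ : 0 < τ.im) (hne : ∃ w, θf τ w ≠ 0) {η a b : ℂ} {N : ℕ}
    (hN : NV (θf τ) (2*η) a b N) (u x : ℂ) :
    ∏ j ∈ Finset.range N, (θf τ (u + η*(1-N) + j * (2*η) + x) * θf τ (u + η*(1-N) + j * (2*η) - x)) =
    (-1)^N * ∑ k ∈ Finset.range (N+1), bet (θf τ) (2*η) a b k (N-k) *
      ekN τ η N k (η*(1 - N) - b) (η*(1 - N) - a) u * ekN τ η N k a b x := by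
  have hodd := thf_odd hτ hne
  rw [kernel_exp (thf_threeTerm hτ) hodd _ x N hN, Finset.mul_sum,
    Finset.Nat.sum_antidiagonal_eq_sum_range_succ_mk]
  refine Finset.sum_congr rfl fun k hk => ?_
  rw [Finset.mem_range] at hk
  simp only
  rw [Gf_eq hodd η a b u k (N-k) N (by omega), ekN_eq, ekN_eq]
  ring

lemma Qp_add (T : ℂ → ℂ) (s x : ℂ) (n p : ℕ) :
    Qp T s x (n + p) = Qp T s x n * Qp T s (x + n * s) p := by
  simp only [Qp, Finset.prod_range_add]
  congr 1
  refine Finset.prod_congr rfl fun j _ => ?_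
  congr 1; push_cast; ring

lemma Qp_negN {T : ℂ → ℂ} (hodd : ∀ x, T (-x) = - T x) (s : ℂ) (k m : ℕ) :
    Qp T s (-((k + m : ℕ) : ℂ) * s) k * Qp T s s m = (-1)^k * Qp T s s (k + m) := by
  induction k with
  | zero => simp [Qp_zero]
  | succ k ih =>
    rw [Qp_succ', show -((k + 1 + m : ℕ) : ℂ) * s = -(s + (k + m : ℕ) * s) by push_cast; ring, hodd,
      show -(s + ((k + m : ℕ) : ℂ) * s) + s = -((k + m : ℕ) : ℂ) * s by push_cast; ring,
      show k + 1 + m = k + m + 1 by ring, Qp_succ T s s (k+m), pow_succ]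
    linear_combination (- T (s + (k + m : ℕ) * s)) * ih

lemma bet_closed {T : ℂ → ℂ} (hodd : ∀ x, T (-x) = - T x) {s a b : ℂ} {k m N : ℕ} (hkm : k + m = N)
    (hN : NV T s a b N) :
    bet T s a b k m * (Qp T s (a - b - N * s + s) N * Qp T s (a + b) N * T (a - b - N * s) *
      (Qp T s s k * Qp T s (a - b + s) k)) =
    (-1)^N * (T (a - b - N * s + 2 * k * s) * (Qp T s (-(N:ℂ) * s) k * Qp T s (a - b - N * s) k)) := by
  have hQk : Qp T s s k ≠ 0 := Qp_ne _ _ _ _ fun j hj => hN.h1 j (by omega)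
  have hQm : Qp T s s m ≠ 0 := Qp_ne _ _ _ _ fun j hj => hN.h1 j (by omega)
  have hQab : Qp T s (a+b) N ≠ 0 := Qp_ne _ _ _ _ fun j hj => hN.h2 j (by omega)
  have hP1 : Qp T s (a - b - m * s) k ≠ 0 := Qp_ne _ _ _ _ fun j hj => by
    have := hN.h3 (j - m) (by omega)
    convert this using 2; push_cast; ring
  have hP2 : Qp T s (a - b + (k - m + 1) * s) m ≠ 0 := Qp_ne _ _ _ _ fun j hj => by
    have := hN.h3 (k - m + 1 + j) (by omega)
    convert this using 2; push_cast; ring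
  have E1 := Qp_negN hodd s k m
  have E2 : Qp T s (a - b - N * s) k * Qp T s (a - b - m * s) k * T (a - b - N * s + 2 * k * s) *
      Qp T s (a - b + (k - m + 1) * s) m =
      T (a - b - N * s) * Qp T s (a - b - N * s + s) N * Qp T s (a - b + s) k := by
    have l : Qp T s (a - b - N * s) (k + (k + (m + 1))) = Qp T s (a - b - N * s) k *
        Qp T s (a - b - m * s) k * T (a - b - N * s + 2 * k * s) *
      Qp T s (a - b + (k - m + 1) * s) m := by
      rw [Qp_add, Qp_add, Qp_succ', ← hkm]
      have e1 : a - b - ((k + m : ℕ) : ℂ) * s + k * s = a - b - m * s := by push_cast; ring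
      have e2 : a - b - m * s + k * s = a - b - ((k + m : ℕ) : ℂ) * s + 2 * k * s := by
        push_cast; ring
      have e3 : a - b - ((k + m : ℕ) : ℂ) * s + 2 * k * s + s = a - b + (k - m + 1) * s := by
        push_cast; ring
      rw [e1, e2, e3]
      ring
    rw [← l, show k + (k + (m+1)) = (N + 1) + k by omega, Qp_add, Qp_succ']
    congr 2
    push_cast; ring
  rw [hkm] at E1
  unfold bet
  rw [hkm, div_mul_eq_mul_div, div_eq_iff (mul_ne_zero (mul_ne_zero (mul_ne_zero
    (mul_ne_zero hQk hQm) hQab) hP1) hP2)]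
  have hp : ((-1:ℂ))^N = (-1)^k * (-1)^m := by rw [← hkm, pow_add]
  have hp2 : ((-1:ℂ))^k * (-1)^k = 1 := by rw [← mul_pow]; simp
  rw [hp]
  linear_combination -((-1)^m * Qp T s s N * Qp T s (a + b) N * Qp T s s k) * E2 -
    ((-1)^k * (-1)^m * Qp T s s k * Qp T s (a + b) N * (Qp T s (a - b - N * s) k *
      Qp T s (a - b - m * s) k * T (a - b - N * s + 2 * k * s) *
      Qp T s (a - b + (k - m + 1) * s) m)) * E1 -
    ((-1)^m * Qp T s s k * Qp T s (a + b) N * (Qp T s (a - b - N * s) k *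
      Qp T s (a - b - m * s) k * T (a - b - N * s + 2 * k * s) *
      Qp T s (a - b + (k - m + 1) * s) m) * Qp T s s N) * hp2

lemma ellFac_eq (τ η x : ℂ) (n : ℕ) : ellFac τ η x n = Qp (θf τ) (2*η) (2*η*x) n := by
  refine Finset.prod_congr rfl fun j _ => ?_
  rw [ell]; congr 1; ring


lemma final_field (sg B B' R R' x1 x2 x3 x4 x5 y1 y2 y3 z1 z2 z3 z4 z5 w1 w2 w3 : ℂ)
    (hsg : sg * sg = 1)
    (h1 : B * (x1 * x2 * x3 * (x4 * x5)) = sg * (y1 * (y2 * y3)))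
    (h2 : B' * (z1 * z2 * z3 * (z4 * z5)) = sg * (w1 * (w2 * w3)))
    (h : B * R = B' * R')
    (hy1 : y1 ≠ 0) (hy2 : y2 ≠ 0) (hy3 : y3 ≠ 0) (hz1 : z1 ≠ 0) (hz2 : z2 ≠ 0) (hz3 : z3 ≠ 0)
    (hz4 : z4 ≠ 0) (hz5 : z5 ≠ 0) :
    R = ((x1 * x2) / (z1 * z2)) * (w1 / z3) * ((w2 * w3) / (z4 * z5)) * (x3 / y1) *
      ((x4 * x5) / (y2 * y3)) * R' := by
  have e : ((x1 * x2) / (z1 * z2)) * (w1 / z3) * ((w2 * w3) / (z4 * z5)) * (x3 / y1) *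
      ((x4 * x5) / (y2 * y3)) * R' = (x1 * x2 * x3 * (x4 * x5)) * (w1 * (w2 * w3)) * R' /
      ((z1 * z2 * z3 * (z4 * z5)) * (y1 * (y2 * y3))) := by
    field_simp
  rw [e, eq_div_iff (by positivity)]
  generalize x1 * x2 * x3 * (x4 * x5) = X at *
  generalize z1 * z2 * z3 * (z4 * z5) = Z at *
  generalize y1 * (y2 * y3) = Y at *
  generalize w1 * (w2 * w3) = W at *
  linear_combination (-R * Z * Y + X * W * R') * hsg - sg * R * Z * h1 + sg * X * R' * h2 +
    sg * X * Z * h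

lemma dual_rel {τ : ℂ} (him : 0 < τ.im) (hne : ∃ w, θf τ w ≠ 0) {N : ℕ} {η a b c d : ℂ}
    (nab : NV (θf τ) (2*η) a b N) (ncd : NV (θf τ) (2*η) c d N)
    (hbasis2 : ∀ h : ℂ → ℂ, ThetaSp τ N h →
      ∃! co : Fin (N + 1) → ℂ, ∀ x, h x = ∑ l : Fin (N + 1), co l * ekN τ η N l c d x)
    (hbasis3 : ∀ h : ℂ → ℂ, ThetaSp τ N h →
      ∃! co : Fin (N + 1) → ℂ, ∀ x, h x =
        ∑ k : Fin (N + 1), co k * ekN τ η N k (η*(1 - N) - b) (η*(1 - N) - a) x)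
    (R : ℕ → ℕ → ℂ)
    (hR : ∀ k ≤ N, ∀ x, ekN τ η N k a b x =
      ∑ l ∈ Finset.range (N + 1), R k l * ekN τ η N l c d x)
    (R' : ℕ → ℕ → ℂ)
    (hR' : ∀ l ≤ N, ∀ x, ekN τ η N l (η*(1 - N) - d) (η*(1 - N) - c) x =
      ∑ k ∈ Finset.range (N + 1), R' l k * ekN τ η N k (η*(1 - N) - b) (η*(1 - N) - a) x)
    (k l : ℕ) (hk : k ≤ N) (hl : l ≤ N) :
    bet (θf τ) (2*η) a b k (N-k) * R k l = bet (θf τ) (2*η) c d l (N-l) * R' l k := by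
  have K : ∀ u x, ∑ k ∈ Finset.range (N+1), bet (θf τ) (2*η) a b k (N-k) *
      ekN τ η N k (η*(1 - N) - b) (η*(1 - N) - a) u * ekN τ η N k a b x =
      ∑ l ∈ Finset.range (N+1), bet (θf τ) (2*η) c d l (N-l) *
      ekN τ η N l (η*(1 - N) - d) (η*(1 - N) - c) u * ekN τ η N l c d x := by
    intro u x
    have h1 := kernel_exp' him hne nab u x
    rw [kernel_exp' him hne ncd u x] at h1
    exact (mul_left_cancel₀ (pow_ne_zero N (by norm_num)) h1).symm
  have K2 : ∀ u, ∀ l ≤ N, ∑ k ∈ Finset.range (N+1), bet (θf τ) (2*η) a b k (N-k) *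
      ekN τ η N k (η*(1 - N) - b) (η*(1 - N) - a) u * R k l -
      bet (θf τ) (2*η) c d l (N-l) * ekN τ η N l (η*(1 - N) - d) (η*(1 - N) - c) u = 0 := by
    intro u l hl
    refine basis_indep hbasis2 (fun l => ∑ k ∈ Finset.range (N+1), bet (θf τ) (2*η) a b k (N-k) *
      ekN τ η N k (η*(1 - N) - b) (η*(1 - N) - a) u * R k l -
      bet (θf τ) (2*η) c d l (N-l) * ekN τ η N l (η*(1 - N) - d) (η*(1 - N) - c) u) ?_ l hl
    intro x
    simp only [sub_mul, Finset.sum_sub_distrib]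
    rw [← K u x, sub_eq_zero]
    simp only [Finset.sum_mul]
    rw [Finset.sum_comm]
    refine Finset.sum_congr rfl fun k hk => ?_
    rw [hR k (by rw [Finset.mem_range] at hk; omega) x, Finset.mul_sum]
    refine Finset.sum_congr rfl fun l _ => ?_
    ring
  have K3 := basis_indep hbasis3 (fun k => bet (θf τ) (2*η) a b k (N-k) * R k l -
    bet (θf τ) (2*η) c d l (N-l) * R' l k) (fun u => by
      have h := K2 u l hl
      rw [hR' l hl u, Finset.mul_sum, ← Finset.sum_sub_distrib] at h
      rw [← h]
      refine Finset.sum_congr rfl fun k _ => ?_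
      ring) k hk
  exact sub_eq_zero.mp K3

/-- Self-duality of elliptic 6j-symbols: the transition coefficients
R_k^l between the bases e_k^N(·;a,b) and e_l^N(·;c,d) are related to the transition
coefficients R′_l^k between e_l^N(·;η(1−N)−d,η(1−N)−c) and e_k^N(·;η(1−N)−b,η(1−N)−a). -/
theorem elliptic_6j_self_duality
    (t : ℝ) (ht : 0 < t) (τ : ℂ) (hτ : τ = t * I)
    (N : ℕ) (η : ℂ)
    (hη : (∃ r : ℝ, η = (r : ℂ) ∧ |r| < 1 / (2 * (N + 1))) ∨
          (∃ s : ℝ, η = (s : ℂ) * I ∧ |s| < t / (2 * (N + 1))))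
    (hη0 : η ≠ 0) (a b c d : ℂ)
    (hbasis1 : ∀ h : ℂ → ℂ, ThetaSp τ N h →
      ∃! co : Fin (N + 1) → ℂ, ∀ x, h x = ∑ k : Fin (N + 1), co k * ekN τ η N k a b x)
    (hbasis2 : ∀ h : ℂ → ℂ, ThetaSp τ N h →
      ∃! co : Fin (N + 1) → ℂ, ∀ x, h x = ∑ l : Fin (N + 1), co l * ekN τ η N l c d x)
    (hbasis3 : ∀ h : ℂ → ℂ, ThetaSp τ N h →
      ∃! co : Fin (N + 1) → ℂ, ∀ x, h x =
        ∑ k : Fin (N + 1), co k * ekN τ η N k (η*(1 - N) - b) (η*(1 - N) - a) x)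
    (hbasis4 : ∀ h : ℂ → ℂ, ThetaSp τ N h →
      ∃! co : Fin (N + 1) → ℂ, ∀ x, h x =
        ∑ l : Fin (N + 1), co l * ekN τ η N l (η*(1 - N) - d) (η*(1 - N) - c) x)
    (R : ℕ → ℕ → ℂ)
    (hR : ∀ k ≤ N, ∀ x, ekN τ η N k a b x =
      ∑ l ∈ Finset.range (N + 1), R k l * ekN τ η N l c d x)
    (R' : ℕ → ℕ → ℂ)
    (hR' : ∀ l ≤ N, ∀ x, ekN τ η N l (η*(1 - N) - d) (η*(1 - N) - c) x =
      ∑ k ∈ Finset.range (N + 1), R' l k * ekN τ η N k (η*(1 - N) - b) (η*(1 - N) - a) x) :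
    ∀ k l : ℕ, k ≤ N → l ≤ N →
      ellFac τ η ((c - d - 2*N*η)/(2*η) + 1) N ≠ 0 →
      ellFac τ η ((c + d)/(2*η)) N ≠ 0 →
      ell τ η ((c - d - 2*N*η)/(2*η)) ≠ 0 →
      ellFac τ η 1 l ≠ 0 →
      ellFac τ η ((c - d - 2*N*η)/(2*η) + N + 1) l ≠ 0 →
      ell τ η ((a - b - 2*N*η)/(2*η) + 2*k) ≠ 0 →
      ellFac τ η (-(N : ℂ)) k ≠ 0 →
      ellFac τ η ((a - b - 2*N*η)/(2*η)) k ≠ 0 →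
      R k l =
        ((ellFac τ η ((a - b - 2*N*η)/(2*η) + 1) N * ellFac τ η ((a + b)/(2*η)) N) /
          (ellFac τ η ((c - d - 2*N*η)/(2*η) + 1) N * ellFac τ η ((c + d)/(2*η)) N)) *
        (ell τ η ((c - d - 2*N*η)/(2*η) + 2*l) / ell τ η ((c - d - 2*N*η)/(2*η))) *
        ((ellFac τ η (-(N : ℂ)) l * ellFac τ η ((c - d - 2*N*η)/(2*η)) l) /
          (ellFac τ η 1 l * ellFac τ η ((c - d - 2*N*η)/(2*η) + N + 1) l)) *
        (ell τ η ((a - b - 2*N*η)/(2*η)) / ell τ η ((a - b - 2*N*η)/(2*η) + 2*k)) *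
        ((ellFac τ η 1 k * ellFac τ η ((a - b - 2*N*η)/(2*η) + N + 1) k) /
          (ellFac τ η (-(N : ℂ)) k * ellFac τ η ((a - b - 2*N*η)/(2*η)) k)) *
        R' l k := by
  intro k l hk hl H1 H2 H3 H4 H5 H6 H7 H8
  have him : 0 < τ.im := by rw [hτ]; simpa using ht
  have hne : ∃ w, θf τ w ≠ 0 := ⟨_, H3⟩
  have hodd := thf_odd him hne
  have hs : ∀ j < N, θf τ ((j + 1) * (2 * η)) ≠ 0 := thf_eta_ne ht hτ hne N η hη hη0
  have nab := basis_NV him hne hs hbasis1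
  have ncd := basis_NV him hne hs hbasis2
  have main := dual_rel him hne nab ncd hbasis2 hbasis3 R hR R' hR' k l hk hl
  have B1 := bet_closed hodd (Nat.add_sub_cancel' hk) nab
  have B2 := bet_closed hodd (Nat.add_sub_cancel' hl) ncd
  have hsg : ((-1:ℂ))^N * (-1)^N = 1 := by rw [← mul_pow]; simp
  have e0 : ∀ x y : ℂ, 2*η*((x - y - 2*N*η)/(2*η)) = x - y - N*(2*η) := by
    intro x y; field_simp
  have e1 : ∀ x y : ℂ, 2*η*((x - y - 2*N*η)/(2*η) + 1) = x - y - N*(2*η) + 2*η := by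
    intro x y; rw [mul_add, e0]; ring
  have e2 : ∀ x y : ℂ, 2*η*((x - y - 2*N*η)/(2*η) + N + 1) = x - y + 2*η := by
    intro x y; rw [mul_add, mul_add, e0]; ring
  have e3 : ∀ (x y : ℂ) (n : ℕ), 2*η*((x - y - 2*N*η)/(2*η) + 2*n) =
      x - y - N*(2*η) + 2*n*(2*η) := by
    intro x y n; rw [mul_add, e0]; ring
  have e4 : ∀ x y : ℂ, 2*η*((x + y)/(2*η)) = x + y := by
    intro x y; field_simp
  have e5 : 2*η*(-(N:ℂ)) = -(N:ℂ)*(2*η) := by ring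
  simp only [ellFac_eq, ell, e0, e1, e2, e3, e4, e5, mul_one] at H1 H2 H3 H4 H5 H6 H7 H8 ⊢
  exact final_field _ _ _ _ _ _ _ _ _ _ _ _ _ _ _ _ _ _ _ _ _ hsg B1 B2 main
    H6 H7 H8 H1 H2 H3 H4 H5
end
end

section
/- Let N be a nonnegative integer and η ∈ (ℝ_N ∪ 𝕀_N) with η ≠ 0. Then the family of kernels {K_v : v ∈ ℂ}, where K_v(u) = e^{2πiuN} ∏_{k=0}^{N−1} θ(u+conj(v)+(2k−N+1)η+1/2+τ/2)·θ(u−conj(v)+(2k−N+1)η+1/2+τ/2), spans the (N+1)-dimensional space Θ_N. -/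
noncomputable section
open Complex MeasureTheory

/-! ### Fourier coefficients of entire periodic functions -/

/-- Fourier coefficient along the real segment `[0,1]`. -/
def fco (f : ℂ → ℂ) (n : ℤ) : ℂ :=
  ∫ x in (0:ℝ)..1, Complex.exp (-(2 * Real.pi * I * n * x)) * f x

lemma fco_zero_imp {f : ℂ → ℂ} (hd : Differentiable ℂ f) (hp : ∀ x, f (x + 1) = f x)
    (h : ∀ n, fco f n = 0) : f = 0 := by
  have : Fact ((0:ℝ) < 1) := ⟨one_pos⟩
  have hper : Function.Periodic (fun x : ℝ => f x) 1 := by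
    intro x
    simpa using hp x
  have hc : Continuous (fun x : ℝ => f x) := hd.continuous.comp continuous_ofReal
  let F : C(AddCircle (1:ℝ), ℂ) := ⟨hper.lift, continuous_coinduced_dom.mpr hc⟩
  have hF : ∀ x : ℝ, F (x : AddCircle (1:ℝ)) = f x := fun x => rfl
  have hco : ∀ n, fourierCoeff F n = 0 := by
    intro n
    rw [fourierCoeff_eq_intervalIntegral F n 0]
    rw [← h n, fco]
    simp only [zero_add, div_one, one_smul]
    refine intervalIntegral.integral_congr fun x _ => ?_
    simp only [hF, smul_eq_mul, fourier_coe_apply]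
    congr 2
    push_cast
    ring
  have hs : Summable (fourierCoeff F) := by
    have : fourierCoeff (F : AddCircle (1:ℝ) → ℂ) = fun _ => 0 := funext hco
    rw [this]; exact summable_zero
  have hz : ∀ x : ℝ, f x = 0 := by
    intro x
    have h1 := has_pointwise_sum_fourier_series_of_summable hs (x : AddCircle (1:ℝ))
    simp only [hco, zero_smul] at h1
    rw [← hF]
    exact h1.unique hasSum_zero
  have ha : AnalyticOnNhd ℂ f Set.univ := fun x _ => hd.analyticAt x
  refine AnalyticOnNhd.eq_of_frequently_eq (z₀ := 0) ha (fun x _ => analyticAt_const) ?_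
  have ht : Filter.Tendsto (fun n : ℕ => (((1 / ((n:ℝ) + 1) : ℝ)) : ℂ)) Filter.atTop
      (nhdsWithin 0 {0}ᶜ) := by
    refine tendsto_nhdsWithin_iff.mpr ⟨?_, ?_⟩
    · have := (continuous_ofReal.tendsto 0).comp (tendsto_one_div_add_atTop_nhds_zero_nat (𝕜 := ℝ))
      simpa [Function.comp_def] using this
    · refine Filter.Eventually.of_forall fun n => ?_
      simp only [Set.mem_compl_iff, Set.mem_singleton_iff, ofReal_eq_zero]
      positivity
  refine ht.frequently (Filter.Frequently.of_forall fun n => ?_)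
  rw [hz]; rfl

lemma shift_integral {F : ℂ → ℂ} (hd : Differentiable ℂ F) (hp : ∀ x, F (x + 1) = F x) (t : ℝ) :
    ∫ x in (0:ℝ)..1, F (x + t * I) = ∫ x in (0:ℝ)..1, F x := by
  have h := integral_boundary_rect_eq_zero_of_differentiableOn F 0 (1 + t * I)
    hd.differentiableOn
  simp at h
  have h2 : ∀ y : ℝ, F (1 + y * I) = F (y * I) := by
    intro y; rw [add_comm, hp]
  simp only [h2] at h
  linear_combination -h

lemma exp_int_period (n : ℤ) (x : ℂ) :
    Complex.exp (-(2 * Real.pi * I * n * (x + 1))) = Complex.exp (-(2 * Real.pi * I * n * x)) := by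
  rw [Complex.exp_eq_exp_iff_exists_int]
  exact ⟨-n, by push_cast; ring⟩

lemma fco_rec {f : ℂ → ℂ} (hd : Differentiable ℂ f) (hp : ∀ x, f (x + 1) = f x) (t : ℝ)
    (C : ℂ) (M : ℤ)
    (hq : ∀ x, f (x + t * I) = C * Complex.exp (-(2 * Real.pi * I * M * x)) * f x) (n : ℤ) :
    fco f n = Complex.exp (-(2 * Real.pi * I * n * (t * I))) * C * fco f (n + M) := by
  unfold fco
  rw [← shift_integral (F := fun x => Complex.exp (-(2 * Real.pi * I * n * x)) * f x)
    (by fun_prop) (fun x => by simp only [hp, exp_int_period]) t]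
  rw [← intervalIntegral.integral_const_mul]
  refine intervalIntegral.integral_congr fun x _ => ?_
  simp only [hq]
  have : Complex.exp (-(2 * Real.pi * I * n * (x + t * I)))
    = Complex.exp (-(2 * Real.pi * I * n * (t * I))) * Complex.exp (-(2 * Real.pi * I * n * x)) := by
    rw [← Complex.exp_add]; congr 1; ring
  have h2 : Complex.exp (-(2 * Real.pi * I * ((n + M : ℤ) : ℂ) * x))
    = Complex.exp (-(2 * Real.pi * I * n * x)) * Complex.exp (-(2 * Real.pi * I * M * x)) := by
    rw [← Complex.exp_add]; congr 1; push_cast; ring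
  rw [this, h2]
  ring

lemma fco_neg {f : ℂ → ℂ} (hp : ∀ x, f (x + 1) = f x)
    (he : ∀ x, f (-x) = f x) (n : ℤ) : fco f (-n) = fco f n := by
  unfold fco
  have h := intervalIntegral.integral_comp_sub_left (a := 0) (b := 1)
    (fun x : ℝ => Complex.exp (-(2 * Real.pi * I * n * x)) * f x) 1
  simp only [sub_self, sub_zero] at h
  rw [← h]
  refine intervalIntegral.integral_congr fun x _ => ?_
  have e1 : f ((1 - x : ℝ) : ℂ) = f x := by
    rw [← he x, ← hp (-x)]; congr 1; push_cast; ring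
  simp only [e1]
  have := exp_int_period n (-x)
  congr 1
  rw [show ((1 - x : ℝ) : ℂ) = -x + 1 by push_cast; ring, this]
  congr 1; push_cast; ring

lemma fco_lin {f g : ℂ → ℂ} (hf : Continuous f) (hg : Continuous g) (a b : ℂ) (n : ℤ) :
    fco (fun x => a * f x + b * g x) n = a * fco f n + b * fco g n := by
  unfold fco
  rw [← intervalIntegral.integral_const_mul, ← intervalIntegral.integral_const_mul,
    ← intervalIntegral.integral_add]
  · refine intervalIntegral.integral_congr fun x _ => ?_
    simp only; ring
  · exact (by fun_prop : Continuous _).intervalIntegrable _ _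
  · exact (by fun_prop : Continuous _).intervalIntegrable _ _

/-- One-dimensionality: if a zeroth coefficient vanishes, a degree one theta function vanishes. -/
lemma deg_one_zero {f : ℂ → ℂ} (hd : Differentiable ℂ f) (hp : ∀ x, f (x + 1) = f x) (t : ℝ)
    (C : ℂ) (hC : C ≠ 0)
    (hq : ∀ x, f (x + t * I) = C * Complex.exp (-(2 * Real.pi * I * (1:ℤ) * x)) * f x)
    (h0 : fco f 0 = 0) : f = 0 := by
  refine fco_zero_imp hd hp fun n => ?_
  have hr := fco_rec hd hp t C 1 hq
  induction n using Int.induction_on with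
  | zero => exact h0
  | succ n ih =>
    have := hr n
    rw [ih] at this
    have hne : Complex.exp (-(2 * Real.pi * I * ((n:ℤ):ℂ) * (t * I))) * C ≠ 0 :=
      mul_ne_zero (Complex.exp_ne_zero _) hC
    exact (mul_eq_zero.mp this.symm).resolve_left hne
  | pred n ih =>
    rw [hr]
    simp [ih]

/-! ### The product -/

/-- Euler type product. -/
def Epr (p z : ℂ) : ℂ := ∏' n : ℕ, (1 + -(p ^ n * z))

lemma Epr_summable {p : ℂ} (hp : ‖p‖ < 1) (z : ℂ) : Summable (fun n : ℕ => ‖-(p ^ n * z)‖) := by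
  simp only [norm_neg, norm_mul, norm_pow]
  exact (summable_geometric_of_lt_one (norm_nonneg _) hp).mul_right _

lemma Epr_diff {p : ℂ} (hp : ‖p‖ < 1) : Differentiable ℂ (Epr p) := by
  rw [← differentiableOn_univ]
  have : HasProdLocallyUniformlyOn (fun (n : ℕ) (z : ℂ) => 1 + -(p ^ n * z)) (Epr p) Set.univ := by
    apply hasProdLocallyUniformlyOn_of_forall_compact isOpen_univ
    intro K _ hK
    obtain ⟨R, hR⟩ := hK.isBounded.exists_norm_le
    refine ((summable_geometric_of_lt_one (norm_nonneg _) hp).mul_right R).hasProdUniformlyOn_nat_one_add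
      hK (.of_forall fun n x hx ↦ ?_) (fun _ ↦ by fun_prop)
    rw [norm_neg, norm_mul, norm_pow]
    exact mul_le_mul_of_nonneg_left (hR x hx) (by positivity)
  refine this.differentiableOn (Filter.Eventually.of_forall fun s ↦ ?_) isOpen_univ
  exact DifferentiableOn.fun_finsetProd (fun _ _ ↦ by fun_prop)

lemma Epr_step {p : ℂ} (hp : ‖p‖ < 1) (z : ℂ) : Epr p z = (1 - z) * Epr p (p * z) := by
  unfold Epr
  rw [tprod_eq_zero_mul']
  · simp only [pow_zero, one_mul, ← sub_eq_add_neg]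
    congr 1
    refine tprod_congr fun n => ?_
    ring
  · have := multipliable_one_add_of_summable (Epr_summable hp (p * z))
    refine this.congr fun n => ?_
    ring

lemma Epr_ne {p : ℂ} (hp : ‖p‖ < 1) (z : ℂ) (h : ∀ n : ℕ, p ^ n * z ≠ 1) : Epr p z ≠ 0 := by
  refine tprod_one_add_ne_zero_of_summable (fun n hn => h n ?_) (Epr_summable hp z)
  linear_combination -hn

/-! ### Zeros of theta -/

/-- Theta product with the same quasi-periodicity as `jacobiTheta₂`. -/
def Gpr (τ z : ℂ) : ℂ :=
  Epr (Complex.exp (2 * Real.pi * I * τ))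
      (-(Complex.exp (Real.pi * I * τ) * Complex.exp (2 * Real.pi * I * z))) *
    Epr (Complex.exp (2 * Real.pi * I * τ))
      (-(Complex.exp (Real.pi * I * τ) * Complex.exp (-(2 * Real.pi * I * z))))

lemma norm_p_lt {t : ℝ} (ht : 0 < t) : ‖Complex.exp (2 * Real.pi * I * (t * I))‖ < 1 := by
  rw [Complex.norm_exp]
  have : (2 * Real.pi * I * (t * I) : ℂ).re = -(2 * Real.pi * t) := by
    simp
  rw [this, Real.exp_lt_one_iff]
  have := Real.pi_pos
  have : 0 < 2 * Real.pi * t := by positivity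
  linarith

lemma Gpr_diff {t : ℝ} (ht : 0 < t) : Differentiable ℂ (Gpr (t * I)) := by
  have h := Epr_diff (norm_p_lt ht)
  unfold Gpr
  fun_prop

lemma Gpr_one (τ z : ℂ) : Gpr τ (z + 1) = Gpr τ z := by
  unfold Gpr
  have h1 : Complex.exp (2 * Real.pi * I * (z + 1)) = Complex.exp (2 * Real.pi * I * z) := by
    rw [mul_add, Complex.exp_add, mul_one, Complex.exp_two_pi_mul_I, mul_one]
  have h2 : Complex.exp (-(2 * Real.pi * I * (z + 1))) = Complex.exp (-(2 * Real.pi * I * z)) := by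
    rw [Complex.exp_neg, h1, ← Complex.exp_neg]
  rw [h1, h2]

lemma Gpr_tau {t : ℝ} (ht : 0 < t) (z : ℂ) : Gpr (t * I) (z + t * I) =
    Complex.exp (-(Real.pi * I * (t * I))) * Complex.exp (-(2 * Real.pi * I * (1:ℤ) * z))
      * Gpr (t * I) z := by
  have hp := norm_p_lt ht
  unfold Gpr
  set τ : ℂ := t * I
  set q := Complex.exp (Real.pi * I * τ) with hq
  set Z := Complex.exp (2 * Real.pi * I * z) with hZ
  have hq0 : q ≠ 0 := Complex.exp_ne_zero _
  have hZ0 : Z ≠ 0 := Complex.exp_ne_zero _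
  have hpq : Complex.exp (2 * Real.pi * I * τ) = q * q := by
    rw [hq, ← Complex.exp_add]; congr 1; ring
  have e1 : Complex.exp (2 * Real.pi * I * (z + τ)) = q * q * Z := by
    rw [← hpq, hZ, ← Complex.exp_add]; congr 1; ring
  have e2 : Complex.exp (-(2 * Real.pi * I * (z + τ))) = (q * q * Z)⁻¹ := by
    rw [Complex.exp_neg, e1]
  have e3 : Complex.exp (-(2 * Real.pi * I * z)) = Z⁻¹ := Complex.exp_neg _
  have e4 : Complex.exp (-(2 * Real.pi * I * (1:ℤ) * z)) = Z⁻¹ := by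
    rw [← e3]; push_cast; ring_nf
  have e5 : Complex.exp (-(Real.pi * I * τ)) = q⁻¹ := Complex.exp_neg _
  rw [e1, e2, e3, e4, e5]
  rw [hpq] at hp ⊢
  rw [Epr_step hp (-(q * (q * q * Z)⁻¹)), Epr_step hp (-(q * Z))]
  have f1 : q * q * -(q * (q * q * Z)⁻¹) = -(q * Z⁻¹) := by field_simp
  have f2 : q * q * -(q * Z) = -(q * (q * q * Z)) := by ring
  rw [f1, f2]
  field_simp
  ring

lemma exp_eq_one_lattice {w : ℂ} (h : Complex.exp (2 * Real.pi * I * w) = 1) : ∃ m : ℤ, w = m := by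
  obtain ⟨m, hm⟩ := Complex.exp_eq_one_iff.mp h
  refine ⟨m, ?_⟩
  have : (2 * Real.pi * I : ℂ) ≠ 0 := Complex.two_pi_I_ne_zero
  apply mul_left_cancel₀ this
  rw [hm]; ring

lemma exp_half (w : ℂ) : Complex.exp (2 * Real.pi * I * (w + 1/2)) =
    -Complex.exp (2 * Real.pi * I * w) := by
  rw [mul_add, Complex.exp_add, show (2 * Real.pi * I * (1/2) : ℂ) = Real.pi * I by ring,
    Complex.exp_pi_mul_I]; ring

lemma Gpr_zero {t : ℝ} (ht : 0 < t) {z : ℂ} (h : Gpr (t * I) z = 0) :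
    ∃ m n : ℤ, z + 1/2 + (t * I) / 2 = m + n * (t * I) := by
  have hp := norm_p_lt ht
  by_contra hcon
  push Not at hcon
  refine mul_ne_zero ?_ ?_ h
  · refine Epr_ne hp _ fun n hn => ?_
    have : Complex.exp (2 * Real.pi * I * ((n * (t * I) + (t * I) / 2 + z) + 1/2)) = 1 := by
      rw [exp_half, ← hn, ← Complex.exp_nat_mul, ← Complex.exp_add, mul_neg, ← Complex.exp_add]
      ring_nf
    obtain ⟨m, hm⟩ := exp_eq_one_lattice this
    refine hcon m (-n) ?_
    push_cast
    linear_combination hm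
  · refine Epr_ne hp _ fun n hn => ?_
    have : Complex.exp (2 * Real.pi * I * ((n * (t * I) + (t * I) / 2 - z) + 1/2)) = 1 := by
      rw [exp_half, ← hn, ← Complex.exp_nat_mul, ← Complex.exp_add, mul_neg, ← Complex.exp_add]
      ring_nf
    obtain ⟨m, hm⟩ := exp_eq_one_lattice this
    refine hcon (1 - m) (n + 1) ?_
    push_cast
    linear_combination -hm

lemma im_pos {t : ℝ} (ht : 0 < t) : 0 < (t * I : ℂ).im := by simpa using ht

lemma jt_diff {t : ℝ} (ht : 0 < t) : Differentiable ℂ (fun z => jacobiTheta₂ z (t * I)) :=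
  fun z => differentiableAt_jacobiTheta₂_fst z (im_pos ht)

lemma jt_ne {t : ℝ} (ht : 0 < t) : jacobiTheta₂ 0 (t * I) ≠ 0 := by
  have hs := hasSum_jacobiTheta₂_term 0 (im_pos ht)
  have hre := Complex.hasSum_re hs
  intro h0
  rw [h0] at hre
  have hterm : ∀ n : ℤ, (jacobiTheta₂_term n 0 (t * I)).re = Real.exp (-(Real.pi * n ^ 2 * t)) := by
    intro n
    rw [jacobiTheta₂_term, ← Complex.ofReal_re (Real.exp _), Complex.ofReal_exp]
    congr 2
    push_cast
    linear_combination (Real.pi * n ^ 2 * t : ℂ) * I_sq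
  simp only [hterm] at hre
  have h1 := le_hasSum hre 0 (fun j _ => (Real.exp_pos _).le)
  simp at h1
  linarith

lemma jt_zero {t : ℝ} (ht : 0 < t) {z : ℂ} (h : jacobiTheta₂ z (t * I) = 0) :
    ∃ m n : ℤ, z + 1/2 + (t * I) / 2 = m + n * (t * I) := by
  apply Gpr_zero ht
  set τ : ℂ := t * I with hτ
  set a := fco (fun z => jacobiTheta₂ z τ) 0 with ha
  set b := fco (Gpr τ) 0 with hb
  have hjq : ∀ x, jacobiTheta₂ (x + t * I) τ = Complex.exp (-(Real.pi * I * (t * I))) *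
      Complex.exp (-(2 * Real.pi * I * (1:ℤ) * x)) * jacobiTheta₂ x τ := by
    intro x
    rw [← hτ, jacobiTheta₂_add_left', ← Complex.exp_add]
    congr 2
    push_cast
    ring
  have hanz : a ≠ 0 := by
    intro h0
    have := deg_one_zero (jt_diff ht) (fun x => jacobiTheta₂_add_left x _) t _
      (Complex.exp_ne_zero _) hjq h0
    exact jt_ne ht (congrFun this 0)
  have key : (fun x => a * Gpr τ x + (-b) * jacobiTheta₂ x τ) = 0 := by
    have hd1 := Gpr_diff ht
    have hd2 := jt_diff ht
    refine deg_one_zero (by fun_prop) (fun x => ?_) t _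
      (Complex.exp_ne_zero (-(Real.pi * I * (t * I)))) (fun x => ?_) ?_
    · simp only [Gpr_one, jacobiTheta₂_add_left]
    · have h1 := hjq x
      have h2 := Gpr_tau ht x
      rw [← hτ] at h1 h2 ⊢
      simp only [h1, h2]; ring
    · rw [fco_lin hd1.continuous hd2.continuous, ← ha, ← hb]; ring
  have := congrFun key z
  simp only [h, mul_zero, add_zero, Pi.zero_apply] at this
  exact (mul_eq_zero.mp this).resolve_left hanz

lemma θf_eq (τ x : ℂ) : θf τ x = I * Complex.exp (Real.pi * I * τ / 4 - Real.pi * I * x) *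
    jacobiTheta₂ (x + 1/2 - τ/2) τ := by
  unfold θf jacobiTheta₂ cπ
  rw [← tsum_mul_left, ← tsum_mul_left]
  refine tsum_congr (fun n => ?_)
  rw [mul_assoc I]
  congr 1
  rw [jacobiTheta₂_term, ← Complex.exp_add, ← Complex.exp_pi_mul_I, ← Complex.exp_int_mul,
    ← Complex.exp_add]
  congr 1
  ring

lemma θf_diff {t : ℝ} (ht : 0 < t) : Differentiable ℂ (θf (t * I)) := by
  have h : Differentiable ℂ (fun z => jacobiTheta₂ z (t * I)) := jt_diff ht
  have : θf (t * I) = fun x => I * Complex.exp (Real.pi * I * (t * I) / 4 - Real.pi * I * x) *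
    jacobiTheta₂ (x + 1/2 - (t * I)/2) (t * I) := funext fun x => θf_eq _ x
  rw [this]
  have h2 : Differentiable ℂ (fun x : ℂ => x + 1/2 - (t * I)/2) := by fun_prop
  have h3 : Differentiable ℂ (fun x : ℂ => jacobiTheta₂ (x + 1/2 - (t * I)/2) (t * I)) := h.comp h2
  exact (by fun_prop : Differentiable ℂ
    (fun x : ℂ => I * Complex.exp (Real.pi * I * (t * I) / 4 - Real.pi * I * x))).mul h3

lemma θf_one (τ x : ℂ) : θf τ (x + 1) = -θf τ x := by
  rw [θf_eq, θf_eq, show x + 1 + 1/2 - τ/2 = (x + 1/2 - τ/2) + 1 by ring, jacobiTheta₂_add_left,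
    show Real.pi * I * τ / 4 - Real.pi * I * (x + 1) = 
      (Real.pi * I * τ / 4 - Real.pi * I * x) - Real.pi * I by ring, Complex.exp_sub,
    Complex.exp_pi_mul_I]
  ring

lemma θf_tau (τ x : ℂ) :
    θf τ (x + τ) = -Complex.exp (-(Real.pi * I * (τ + 2 * x))) * θf τ x := by
  rw [θf_eq, θf_eq, show x + τ + 1/2 - τ/2 = (x + 1/2 - τ/2) + τ by ring, jacobiTheta₂_add_left',
    show Real.pi * I * τ / 4 - Real.pi * I * (x + τ) = 
      (Real.pi * I * τ / 4 - Real.pi * I * x) + -(Real.pi * I * τ) by ring, Complex.exp_add,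
    show -Real.pi * I * (τ + 2 * (x + 1 / 2 - τ / 2)) =
      -(Real.pi * I * (τ + 2 * x)) + Real.pi * I * τ - Real.pi * I by ring,
    Complex.exp_sub (_ + _), Complex.exp_add _ (Real.pi * I * τ), Complex.exp_pi_mul_I,
    Complex.exp_neg (Real.pi * I * τ)]
  have := Complex.exp_ne_zero (Real.pi * I * τ)
  field_simp

lemma θf_neg (τ x : ℂ) : θf τ (-x) = -θf τ x := by
  rw [θf_eq, θf_eq, ← jacobiTheta₂_neg_left, ← jacobiTheta₂_add_left,
    show -(-x + 1/2 - τ/2) + 1 = (x + 1/2 - τ/2) + τ by ring, jacobiTheta₂_add_left',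
    show Real.pi * I * τ / 4 - Real.pi * I * (-x) = 
      (Real.pi * I * τ / 4 - Real.pi * I * x) + 2 * (Real.pi * I * x) by ring, Complex.exp_add,
    show -Real.pi * I * (τ + 2 * (x + 1 / 2 - τ / 2)) =
      -(2 * (Real.pi * I * x)) - Real.pi * I by ring,
    Complex.exp_sub (-_), Complex.exp_pi_mul_I, Complex.exp_neg]
  have := Complex.exp_ne_zero (2 * (Real.pi * I * x))
  field_simp

lemma θf_zero (τ : ℂ) : θf τ 0 = 0 := by
  have := θf_neg τ 0
  rw [neg_zero] at this
  linear_combination this / 2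

lemma θf_ne {t : ℝ} (ht : 0 < t) {x : ℂ} (h : ∀ m n : ℤ, x ≠ m + n * (t * I)) :
    θf (t * I) x ≠ 0 := by
  rw [θf_eq]
  refine mul_ne_zero (mul_ne_zero I_ne_zero (Complex.exp_ne_zero _)) fun h0 => ?_
  obtain ⟨m, n, hmn⟩ := jt_zero ht h0
  refine h (m - 1) n ?_
  push_cast
  linear_combination hmn

/-! ### The kernels -/

/-- One factor of the kernel. -/
def pr (τ η u w c : ℂ) : ℂ :=
  θf τ (u + w + c * η + 1/2 + τ/2) * θf τ (u - w + c * η + 1/2 + τ/2)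

lemma Kk_eq (τ η : ℂ) (N : ℕ) (u w : ℂ) : Kk τ η N u w =
    Complex.exp (2 * Real.pi * I * u * N) *
      ∏ k ∈ Finset.range N, pr τ η u w (2 * (k:ℂ) - N + 1) := rfl

lemma pr_one (τ η u w c : ℂ) : pr τ η (u + 1) w c = pr τ η u w c := by
  unfold pr
  rw [show u + 1 + w + c * η + 1/2 + τ/2 = (u + w + c * η + 1/2 + τ/2) + 1 by ring,
    show u + 1 - w + c * η + 1/2 + τ/2 = (u - w + c * η + 1/2 + τ/2) + 1 by ring, θf_one, θf_one]
  ring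

lemma pr_tau (τ η u w c : ℂ) : pr τ η (u + τ) w c =
    Complex.exp (-(4 * Real.pi * I * (τ + u)) + (-(4 * Real.pi * I * η)) * c) * pr τ η u w c := by
  unfold pr
  rw [show u + τ + w + c * η + 1/2 + τ/2 = (u + w + c * η + 1/2 + τ/2) + τ by ring,
    show u + τ - w + c * η + 1/2 + τ/2 = (u - w + c * η + 1/2 + τ/2) + τ by ring, θf_tau, θf_tau]
  have : Complex.exp (-(4 * Real.pi * I * (τ + u)) + (-(4 * Real.pi * I * η)) * c) =
    Complex.exp (-(Real.pi * I * (τ + 2 * (u + w + c * η + 1/2 + τ/2)))) *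
    Complex.exp (-(Real.pi * I * (τ + 2 * (u - w + c * η + 1/2 + τ/2)))) := by
    rw [← Complex.exp_add, Complex.exp_eq_exp_iff_exists_int]
    exact ⟨1, by push_cast; ring⟩
  rw [this]
  ring

lemma θf_shift (τ y : ℂ) :
    θf τ y = Complex.exp (Real.pi * I * (τ + 2 * y)) * θf τ (y + τ + 1) := by
  rw [θf_one, θf_tau, Complex.exp_neg]
  have := Complex.exp_ne_zero (Real.pi * I * (τ + 2 * y))
  field_simp

lemma pr_neg (τ η u w c : ℂ) : pr τ η (-u) w c =
    Complex.exp (4 * Real.pi * I * u + (-(4 * Real.pi * I * η)) * c) * pr τ η u w (-c) := by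
  unfold pr
  rw [show -u + w + c * η + 1/2 + τ/2 = -(u - w - c * η - 1/2 - τ/2) by ring,
    show -u - w + c * η + 1/2 + τ/2 = -(u + w - c * η - 1/2 - τ/2) by ring, θf_neg, θf_neg,
    θf_shift τ (u - w - c * η - 1/2 - τ/2), θf_shift τ (u + w - c * η - 1/2 - τ/2),
    show u - w - c * η - 1/2 - τ/2 + τ + 1 = u - w + -c * η + 1/2 + τ/2 by ring,
    show u + w - c * η - 1/2 - τ/2 + τ + 1 = u + w + -c * η + 1/2 + τ/2 by ring]
  have : Complex.exp (4 * Real.pi * I * u + (-(4 * Real.pi * I * η)) * c) =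
    Complex.exp (Real.pi * I * (τ + 2 * (u - w - c * η - 1/2 - τ/2))) *
    Complex.exp (Real.pi * I * (τ + 2 * (u + w - c * η - 1/2 - τ/2))) := by
    rw [← Complex.exp_add, Complex.exp_eq_exp_iff_exists_int]
    exact ⟨1, by push_cast; ring⟩
  rw [this]
  ring

lemma sum_c (N : ℕ) : ∑ k ∈ Finset.range N, (2 * (k:ℂ) - N + 1) = 0 := by
  have h : ∀ M : ℂ, ∑ k ∈ Finset.range N, (2 * (k:ℂ) - M + 1) = N * (N - M) := by
    intro M
    induction N with
    | zero => simp
    | succ n ih => rw [Finset.sum_range_succ, ih]; push_cast; ring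
  rw [h]; ring

lemma prod_exp_c (N : ℕ) (a b : ℂ) :
    ∏ k ∈ Finset.range N, Complex.exp (a + b * (2 * (k:ℂ) - N + 1)) = Complex.exp (N * a) := by
  rw [← Complex.exp_sum, Finset.sum_add_distrib, ← Finset.mul_sum, sum_c]
  simp

lemma Kk_mem {t : ℝ} (ht : 0 < t) (η : ℂ) (N : ℕ) (w : ℂ) :
    ThetaSp (t * I) N (fun u => Kk (t * I) η N u w) := by
  refine ⟨?_, ?_, ?_, ?_⟩
  · have hd := θf_diff ht
    unfold Kk
    refine Differentiable.mul (by fun_prop) ?_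
    refine Differentiable.fun_finsetProd fun k _ => ?_
    fun_prop
  · intro u
    simp only [Kk_eq, pr_one]
    congr 1
    rw [Complex.exp_eq_exp_iff_exists_int]
    exact ⟨N, by push_cast; ring⟩
  · intro u
    simp only [Kk_eq, pr_tau, Finset.prod_mul_distrib, prod_exp_c]
    rw [← mul_assoc, ← mul_assoc, ← Complex.exp_add, ← Complex.exp_add]
    congr 2
    unfold cπ
    ring
  · intro u
    simp only [Kk_eq, pr_neg, Finset.prod_mul_distrib, prod_exp_c]
    rw [← mul_assoc, ← Complex.exp_add]
    congr 1
    · congr 1; ring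
    · rw [← Finset.prod_range_reflect]
      refine Finset.prod_congr rfl fun k hk => ?_
      congr 1
      have hk' : k + 1 ≤ N := Finset.mem_range.mp hk
      rw [Nat.sub_sub, add_comm 1 k]
      push_cast [hk']
      ring

lemma pr_pt (τ η w0 : ℂ) (N i j k : ℕ) :
    pr τ η (w0 - (1/2 + τ/2) + (2 * (j:ℂ) - 1 - N) * η) (w0 + 2 * (i:ℂ) * η) (2 * (k:ℂ) - N + 1) =
      θf τ (2 * w0 + 2 * (((i:ℤ) + j + k - N : ℤ) : ℂ) * η) *
      θf τ (2 * (((j:ℤ) - i + k - N : ℤ) : ℂ) * η) := by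
  unfold pr
  congr 2 <;> push_cast <;> ring

lemma Kk_lt (τ η w0 : ℂ) (N i j : ℕ) (hij : i < j) (hj : j ≤ N) :
    Kk τ η N (w0 - (1/2 + τ/2) + (2 * (j:ℂ) - 1 - N) * η) (w0 + 2 * (i:ℂ) * η) = 0 := by
  rw [Kk_eq]
  apply mul_eq_zero_of_right
  refine Finset.prod_eq_zero (i := N - (j - i)) (Finset.mem_range.mpr (by omega)) ?_
  rw [pr_pt, show ((j:ℤ) - i + (N - (j - i) : ℕ) - N : ℤ) = 0 by omega]
  simp [θf_zero]

lemma Kk_diag (τ η w0 : ℂ) (N i : ℕ)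
    (hA : ∀ n : ℤ, n ≠ 0 → |n| ≤ N → θf τ (2 * (n:ℂ) * η) ≠ 0)
    (hB : ∀ n : ℤ, θf τ (2 * w0 + 2 * (n:ℂ) * η) ≠ 0) :
    Kk τ η N (w0 - (1/2 + τ/2) + (2 * (i:ℂ) - 1 - N) * η) (w0 + 2 * (i:ℂ) * η) ≠ 0 := by
  rw [Kk_eq]
  refine mul_ne_zero (Complex.exp_ne_zero _) (Finset.prod_ne_zero_iff.mpr fun k hk => ?_)
  have hk' := Finset.mem_range.mp hk
  rw [pr_pt]
  refine mul_ne_zero (hB _) (hA _ (by omega) ?_)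
  rw [abs_le]; omega

lemma ThetaSp_zero {t : ℝ} (ht : 0 < t) {N : ℕ} {f : ℂ → ℂ} (hf : ThetaSp (t * I) N f)
    (h0 : ∀ n : ℕ, n ≤ N → fco f n = 0) : f = 0 := by
  obtain ⟨hd, hp, hq, he⟩ := hf
  refine fco_zero_imp hd hp ?_
  have hr := fco_rec hd hp t (Complex.exp (-(2 * Real.pi * I * N * (t * I)))) (2 * N) (by
    intro x
    rw [hq, ← Complex.exp_add]
    congr 2
    unfold cπ
    push_cast
    ring)
  suffices hnat : ∀ n : ℕ, fco f n = 0 by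
    intro n
    obtain ⟨m, rfl | rfl⟩ := n.eq_nat_or_neg
    · exact hnat m
    · rw [fco_neg hp he]; exact hnat m
  intro n
  induction n using Nat.strong_induction_on with
  | _ n ih =>
    by_cases hn : n ≤ N
    · exact h0 n hn
    rcases Nat.eq_zero_or_pos N with rfl | hN
    · have h1 := hr n
      simp only [Nat.cast_zero, mul_zero, zero_mul, neg_zero, Complex.exp_zero, mul_one,
        add_zero] at h1
      by_contra hne
      have h2 : Complex.exp (-(2 * Real.pi * I * (n:ℤ) * (t * I))) = 1 := by
        apply mul_right_cancel₀ hne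
        rw [one_mul]; exact h1.symm
      have h3 : Complex.exp (((2 * Real.pi * n * t : ℝ)) : ℂ) = 1 := by
        rw [← h2]; congr 1; push_cast
        linear_combination (2 * Real.pi * n * t : ℂ) * I_sq
      rw [← Complex.ofReal_exp] at h3
      have h4 : Real.exp (2 * Real.pi * n * t) = 1 := by exact_mod_cast h3
      rw [Real.exp_eq_one_iff] at h4
      have : 0 < (n:ℝ) := by exact_mod_cast (by omega : 0 < n)
      have := Real.pi_pos
      have : 0 < 2 * Real.pi * n * t := by positivity
      linarith
    · have h1 := hr ((n:ℤ) - 2 * N)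
      have h2 : fco f ((n:ℤ) - 2 * N) = 0 := by
        rcases le_total (2 * N) n with h | h
        · have := ih (n - 2 * N) (by omega)
          rw [← this]; congr 1; omega
        · have := ih (2 * N - n) (by omega)
          rw [← this, ← fco_neg hp he]; congr 1; omega
      rw [h2, sub_add_cancel] at h1
      exact (mul_eq_zero.mp h1.symm).resolve_left
        (mul_ne_zero (Complex.exp_ne_zero _) (Complex.exp_ne_zero _))

/-- `Θ_N` as a submodule. -/
def ThW (τ : ℂ) (N : ℕ) : Submodule ℂ (ℂ → ℂ) where
  carrier := {f | ThetaSp τ N f}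
  add_mem' := by
    rintro f g ⟨h1, h2, h3, h4⟩ ⟨k1, k2, k3, k4⟩
    exact ⟨h1.add k1, fun x => by simp [h2, k2], fun x => by simp only [Pi.add_apply, h3, k3]; ring,
      fun x => by simp [h4, k4]⟩
  zero_mem' := ⟨differentiable_const 0, fun x => rfl, fun x => by simp, fun x => rfl⟩
  smul_mem' := by
    rintro c f ⟨h1, h2, h3, h4⟩
    exact ⟨h1.const_smul c, fun x => by simp [h2],
      fun x => by simp only [Pi.smul_apply, h3, smul_eq_mul]; ring, fun x => by simp [h4]⟩

/-- The coefficient map. -/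
def coW (τ : ℂ) (N : ℕ) : ThW τ N →ₗ[ℂ] (Fin (N + 1) → ℂ) where
  toFun f := fun n => fco f.1 (n : ℕ)
  map_add' := by
    intro f g
    funext n
    have := fco_lin f.2.1.continuous g.2.1.continuous 1 1 (n : ℕ)
    simp only [one_mul] at this
    exact this
  map_smul' := by
    intro c f
    funext n
    have := fco_lin f.2.1.continuous f.2.1.continuous c 0 (n : ℕ)
    simp only [zero_mul, add_zero] at this
    exact this

lemma coW_inj {t : ℝ} (ht : 0 < t) (N : ℕ) : Function.Injective (coW (t * I) N) := by
  rw [injective_iff_map_eq_zero]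
  intro f hf
  apply Subtype.ext
  refine ThetaSp_zero ht f.2 fun n hn => ?_
  exact congrFun hf ⟨n, by omega⟩

lemma span_main {t : ℝ} (ht : 0 < t) (η w0 : ℂ) (N : ℕ)
    (hA : ∀ n : ℤ, n ≠ 0 → |n| ≤ N → θf (t * I) (2 * (n:ℂ) * η) ≠ 0)
    (hB : ∀ n : ℤ, θf (t * I) (2 * w0 + 2 * (n:ℂ) * η) ≠ 0)
    (f : ℂ → ℂ) (hf : ThetaSp (t * I) N f) :
    f ∈ Submodule.span ℂ (Set.range (fun w : ℂ => (fun u => Kk (t * I) η N u w))) := by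
  let b : Fin (N + 1) → ThW (t * I) N :=
    fun i => ⟨fun u => Kk (t * I) η N u (w0 + 2 * ((i:ℕ):ℂ) * η), Kk_mem ht η N _⟩
  have hb : LinearIndependent ℂ b := by
    rw [Fintype.linearIndependent_iff]
    intro g hg
    have hev : ∀ j : Fin (N + 1), ∑ i, g i * Kk (t * I) η N
        (w0 - (1/2 + (t * I)/2) + (2 * ((j:ℕ):ℂ) - 1 - N) * η) (w0 + 2 * ((i:ℕ):ℂ) * η) = 0 := by
      intro j
      have := congrFun (congrArg Subtype.val hg)
        (w0 - (1/2 + (t * I)/2) + (2 * ((j:ℕ):ℂ) - 1 - N) * η)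
      simpa [b, Finset.sum_apply] using this
    have hdown : ∀ d : ℕ, ∀ j : Fin (N + 1), N - (j:ℕ) = d → g j = 0 := by
      intro d
      induction d using Nat.strong_induction_on with
      | _ d ih =>
        intro j hj
        have h1 := hev j
        rw [Finset.sum_eq_single j] at h1
        · exact (mul_eq_zero.mp h1).resolve_right (Kk_diag _ _ _ _ _ hA hB)
        · intro i _ hij
          rcases lt_or_gt_of_ne hij with h | h
          · rw [Kk_lt _ _ _ _ _ _ h (by omega), mul_zero]
          · rw [ih (N - (i:ℕ)) (by have : (j:ℕ) < i := h; omega) i rfl, zero_mul]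
        · simp
    exact fun j => hdown _ j rfl
  have : FiniteDimensional ℂ (ThW (t * I) N) :=
    FiniteDimensional.of_injective (coW (t * I) N) (coW_inj ht N)
  have hle : Module.finrank ℂ (ThW (t * I) N) ≤ N + 1 := by
    have := LinearMap.finrank_le_finrank_of_injective (coW_inj ht N)
    simpa using this
  have hge := hb.fintype_card_le_finrank
  have hspan := hb.span_eq_top_of_card_eq_finrank' (by
    simp only [Fintype.card_fin] at hge ⊢; omega)
  have hmem : (⟨f, hf⟩ : ThW (t * I) N) ∈ Submodule.span ℂ (Set.range b) := by
    rw [hspan]; trivial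
  have h2 := Submodule.mem_map_of_mem (f := (ThW (t * I) N).subtype) hmem
  rw [Submodule.map_span] at h2
  refine Submodule.span_mono ?_ h2
  rintro _ ⟨_, ⟨i, rfl⟩, rfl⟩
  exact ⟨_, rfl⟩

lemma hAB {t : ℝ} (ht : 0 < t) (N : ℕ) (η : ℂ)
    (hη : (∃ r : ℝ, η = (r : ℂ) ∧ |r| < 1 / (2 * (N + 1))) ∨
          (∃ s : ℝ, η = (s : ℂ) * I ∧ |s| < t / (2 * (N + 1))))
    (hη0 : η ≠ 0) :
    (∀ n : ℤ, n ≠ 0 → |n| ≤ N → θf (t * I) (2 * (n:ℂ) * η) ≠ 0) ∧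
    ∃ w0 : ℂ, ∀ n : ℤ, θf (t * I) (2 * w0 + 2 * (n:ℂ) * η) ≠ 0 := by
  have hN : (0:ℝ) < 2 * (N + 1) := by positivity
  rcases hη with ⟨r, rfl, hr⟩ | ⟨s, rfl, hs⟩
  · have hr0 : r ≠ 0 := by rintro rfl; simp at hη0
    rw [lt_div_iff₀ hN] at hr
    refine ⟨fun n hn hnN => θf_ne ht fun a b hab => ?_, t * I / 4, fun n => θf_ne ht fun a b hab => ?_⟩
    · have hre := congrArg Complex.re hab
      simp at hre
      have hn1 : |(n:ℝ)| ≤ N := by exact_mod_cast hnN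
      have : |(a:ℝ)| < 1 := by
        rw [← hre, abs_mul, abs_mul, abs_two]
        nlinarith [abs_nonneg r, abs_nonneg (n:ℝ), abs_pos.mpr hr0]
      have ha : a = 0 := by
        have : |a| < 1 := by exact_mod_cast this
        exact Int.abs_lt_one_iff.mp this
      subst ha
      simp [hn, hr0] at hre
    · have him := congrArg Complex.im hab
      simp at him
      have h2 : (t:ℝ) * (1 - 2 * b) = 0 := by linarith
      have h3 : (1:ℝ) - 2 * b = 0 := (mul_eq_zero.mp h2).resolve_left ht.ne'
      have h4 : (1:ℤ) - 2 * b = 0 := by exact_mod_cast h3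
      omega
  · have hs0 : s ≠ 0 := by rintro rfl; simp at hη0
    rw [lt_div_iff₀ hN] at hs
    refine ⟨fun n hn hnN => θf_ne ht fun a b hab => ?_, 1 / 4, fun n => θf_ne ht fun a b hab => ?_⟩
    · have him := congrArg Complex.im hab
      simp at him
      have hn1 : |(n:ℝ)| ≤ N := by exact_mod_cast hnN
      have h1 : |(b:ℝ) * t| < t := by
        rw [← him, abs_mul, abs_mul, abs_two]
        nlinarith [abs_nonneg s, abs_nonneg (n:ℝ), abs_pos.mpr hs0]
      have : |(b:ℝ)| < 1 := by
        rw [abs_mul, abs_of_pos ht] at h1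
        by_contra hcon
        push Not at hcon
        nlinarith
      have hb : b = 0 := by
        have : |b| < 1 := by exact_mod_cast this
        exact Int.abs_lt_one_iff.mp this
      subst hb
      simp [hn, hs0] at him
    · have hre := congrArg Complex.re hab
      simp at hre
      have h3 : (1:ℝ) - 2 * a = 0 := by linarith
      have h4 : (1:ℤ) - 2 * a = 0 := by exact_mod_cast h3
      omega

/-- The kernels K_v, v ∈ ℂ, all lie in Θ_N and span Θ_N. -/
theorem kernels_span_thetaSp
    (t : ℝ) (ht : 0 < t) (τ : ℂ) (hτ : τ = t * I)
    (N : ℕ) (η : ℂ)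
    (hη : (∃ r : ℝ, η = (r : ℂ) ∧ |r| < 1 / (2 * (N + 1))) ∨
          (∃ s : ℝ, η = (s : ℂ) * I ∧ |s| < t / (2 * (N + 1))))
    (hη0 : η ≠ 0) :
    (∀ v : ℂ, ThetaSp τ N (fun u => Kk τ η N u ((starRingEnd ℂ) v))) ∧
    (∀ f : ℂ → ℂ, ThetaSp τ N f →
      f ∈ Submodule.span ℂ
        (Set.range (fun v : ℂ => (fun u => Kk τ η N u ((starRingEnd ℂ) v))))) := by
  subst hτ
  refine ⟨fun v => Kk_mem ht η N _, fun f hf => ?_⟩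
  obtain ⟨hA, w0, hB⟩ := hAB ht N η hη hη0
  refine Submodule.span_mono ?_ (span_main ht η w0 N hA hB f hf)
  rintro _ ⟨w, rfl⟩
  exact ⟨(starRingEnd ℂ) w, by simp⟩
end
end

section
/- For all u, v, y ∈ ℂ such that θ(u+y), θ(u−y), θ(v+y), θ(v−y) and θ(2y) are nonzero, one has θ(u+v)θ(u−v) / (θ(u+y)θ(u−y)θ(v+y)θ(v−y)) = (1/(θ′(0)·θ(2y))) · ( θ′(u+y)/θ(u+y) − θ′(u−y)/θ(u−y) + θ′(v−y)/θ(v−y) − θ′(v+y)/θ(v+y) ), where θ′ is the derivative of θ and θ′(0) = 2π p^{1/8}(p;p)_∞³. -/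
noncomputable section
open Complex MeasureTheory

lemma thetaf_term (τ x : ℂ) (n : ℤ) :
    (-1 : ℂ) ^ n *
      Complex.exp (cπ * I * τ * ((n : ℂ) - 1/2)^2 + cπ * I * (2*(n : ℂ) - 1) * x) =
    Complex.exp (cπ * I * τ / 4 - cπ * I * x) * jacobiTheta₂_term n (x + 1/2 - τ/2) τ := by
  rw [← Complex.exp_pi_mul_I, ← Complex.exp_int_mul, ← Complex.exp_add, jacobiTheta₂_term,
    ← Complex.exp_add]
  congr 1
  simp only [cπ]
  ring

lemma thetaf_eq (τ x : ℂ) :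
    θf τ x = I * (Complex.exp (cπ * I * τ / 4 - cπ * I * x) *
      jacobiTheta₂ (x + 1/2 - τ/2) τ) := by
  rw [θf, jacobiTheta₂, ← tsum_mul_left (a := Complex.exp _)]
  simp_rw [thetaf_term]

lemma thetaf_summable (τ x : ℂ) (hτ : 0 < τ.im) :
    Summable fun n : ℤ => (-1 : ℂ) ^ n *
      Complex.exp (cπ * I * τ * ((n : ℂ) - 1/2)^2 + cπ * I * (2*(n : ℂ) - 1) * x) := by
  simp_rw [thetaf_term]
  exact ((summable_jacobiTheta₂_term_iff _ _).2 hτ).mul_left _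

lemma thetaf_hasDerivAt (τ x : ℂ) (hτ : 0 < τ.im) :
    HasDerivAt (θf τ) (I * (Complex.exp (cπ * I * τ / 4 - cπ * I * x) *
      (jacobiTheta₂' (x + 1/2 - τ/2) τ - cπ * I * jacobiTheta₂ (x + 1/2 - τ/2) τ))) x := by
  have h1 : HasDerivAt (fun x : ℂ => cπ * I * τ / 4 - cπ * I * x) (-(cπ * I)) x := by
    simpa using ((hasDerivAt_id x).const_mul (cπ * I)).const_sub (cπ * I * τ / 4)
  have h2 : HasDerivAt (fun x : ℂ => x + 1/2 - τ/2) 1 x :=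
    ((hasDerivAt_id x).add_const _).sub_const _
  have h3 := (hasDerivAt_jacobiTheta₂_fst (x + 1/2 - τ/2) hτ).comp x h2
  have h4 := (h1.cexp.mul h3).const_mul I
  have : θf τ = fun x => I * (Complex.exp (cπ * I * τ / 4 - cπ * I * x) *
      jacobiTheta₂ (x + 1/2 - τ/2) τ) := funext (thetaf_eq τ)
  rw [this]
  refine h4.congr_deriv ?_
  simp only [Function.comp]
  ring

lemma thetaf_deriv_zero (τ : ℂ) (hτ : 0 < τ.im) :
    HasSum (fun n : ℤ => (2 * (n : ℂ) - 1) * ((-1 : ℂ) ^ n *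
      Complex.exp (cπ * I * τ * n * (n - 1))))
      (- deriv (θf τ) 0 / (cπ * Complex.exp (cπ * I * τ / 4))) := by
  rw [(thetaf_hasDerivAt τ 0 hτ).deriv]
  have hs := (hasSum_jacobiTheta₂'_term (0 + 1/2 - τ/2) hτ).sub
    ((hasSum_jacobiTheta₂_term (0 + 1/2 - τ/2) hτ).mul_left (cπ * I))
  have hp : cπ ≠ 0 := by simp [cπ, Real.pi_ne_zero]
  have hs2 := hs.mul_left ((cπ * I)⁻¹)
  have hI : cπ * I ≠ 0 := mul_ne_zero hp I_ne_zero
  have hv : -(I * (Complex.exp (cπ * I * τ / 4 - cπ * I * 0) *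
      (jacobiTheta₂' (0 + 1/2 - τ/2) τ - cπ * I * jacobiTheta₂ (0 + 1/2 - τ/2) τ))) /
      (cπ * Complex.exp (cπ * I * τ / 4)) = (cπ * I)⁻¹ *
      (jacobiTheta₂' (0 + 1/2 - τ/2) τ - cπ * I * jacobiTheta₂ (0 + 1/2 - τ/2) τ) := by
    have := Complex.exp_ne_zero (cπ * I * τ / 4)
    rw [mul_zero, sub_zero, mul_inv, inv_I]
    field_simp
  rw [hv]
  refine hs2.congr_fun fun n => ?_
  have e : jacobiTheta₂_term n (0 + 1/2 - τ/2) τ =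
      (-1 : ℂ) ^ n * Complex.exp (cπ * I * τ * n * (n - 1)) := by
    rw [← Complex.exp_pi_mul_I, ← Complex.exp_int_mul, ← Complex.exp_add, jacobiTheta₂_term]
    congr 1
    simp only [cπ]
    ring
  rw [jacobiTheta₂'_term, e]
  rw [eq_inv_mul_iff_mul_eq₀ hI]
  simp only [cπ]
  ring

def thE (τ x : ℂ) : ℂ := ∑' a : ℤ, jacobiTheta₂_term (2 * a) x (τ/2)
def thO (τ x : ℂ) : ℂ := ∑' a : ℤ, jacobiTheta₂_term (2 * a + 1) x (τ/2)

def thEquivFun : (ℤ × ℤ) ⊕ (ℤ × ℤ) → ℤ × ℤ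
  | .inl (a, b) => (a + b + 1, a - b)
  | .inr (a, b) => (a + b + 1, a - b + 1)

lemma thEquivFun_bij : Function.Bijective thEquivFun := by
  constructor
  · rintro (⟨a, b⟩ | ⟨a, b⟩) (⟨c, d⟩ | ⟨c, d⟩) h <;>
      simp only [thEquivFun, Prod.mk.injEq, Sum.inl.injEq, Sum.inr.injEq, reduceCtorEq] at h ⊢ <;>
      omega
  · rintro ⟨m, n⟩
    rcases Int.even_or_odd' (m - n) with ⟨b, hb | hb⟩
    · refine ⟨.inr (n + b - 1, b), ?_⟩
      simp only [thEquivFun, Prod.mk.injEq]; omega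
    · refine ⟨.inl (n + b, b), ?_⟩
      simp only [thEquivFun, Prod.mk.injEq]; omega

lemma thetaf_mul (τ x y : ℂ) (hτ : 0 < τ.im) :
    θf τ (x + y) * θf τ (x - y) = thE τ x * thO τ y - thO τ x * thE τ y := by
  have hτ2 : 0 < (τ/2).im := by simpa using hτ
  have hg (z : ℂ) := (summable_jacobiTheta₂_term_iff z (τ/2)).2 hτ2
  have hE (z : ℂ) : Summable fun a : ℤ => jacobiTheta₂_term (2 * a) z (τ/2) :=
    (hg z).comp_injective (fun a b h => by simpa using h)
  have hO (z : ℂ) : Summable fun a : ℤ => jacobiTheta₂_term (2 * a + 1) z (τ/2) :=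
    (hg z).comp_injective (fun a b h => by simpa using h)
  have s1 := (thetaf_summable τ (x + y) hτ)
  have s2 := (thetaf_summable τ (x - y) hτ)
  have p0 := (summable_mul_of_summable_norm s1.norm s2.norm).hasSum
  rw [← tsum_mul_tsum_of_summable_norm s1.norm s2.norm] at p0
  have p1 := (summable_mul_of_summable_norm (hE x).norm (hO y).norm).hasSum
  rw [← tsum_mul_tsum_of_summable_norm (hE x).norm (hO y).norm] at p1
  have p2 := (summable_mul_of_summable_norm (hO x).norm (hE y).norm).hasSum
  rw [← tsum_mul_tsum_of_summable_norm (hO x).norm (hE y).norm] at p2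
  have q0 := (Equiv.ofBijective _ thEquivFun_bij).hasSum_iff.2 p0
  have key (m n s d : ℤ) (h1 : 2 * m - 1 = s + d) (h2 : 2 * n - 1 = s - d) (ε : ℂ)
      (hε : (-1 : ℂ) ^ (m + n) = ε) :
      ((-1 : ℂ) ^ m *
      Complex.exp (cπ * I * τ * ((m : ℂ) - 1/2)^2 + cπ * I * (2*(m : ℂ) - 1) * (x + y))) *
      ((-1 : ℂ) ^ n *
      Complex.exp (cπ * I * τ * ((n : ℂ) - 1/2)^2 + cπ * I * (2*(n : ℂ) - 1) * (x - y))) =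
      ε * (jacobiTheta₂_term s x (τ/2) * jacobiTheta₂_term d y (τ/2)) := by
    rw [mul_mul_mul_comm, ← zpow_add₀ (by norm_num), hε, ← Complex.exp_add, jacobiTheta₂_term,
      jacobiTheta₂_term, ← Complex.exp_add]
    congr 2
    have h1' : 2 * (m : ℂ) - 1 = s + d := by exact_mod_cast h1
    have h2' : 2 * (n : ℂ) - 1 = s - d := by exact_mod_cast h2
    have e1 : (m : ℂ) = (s + d + 1) / 2 := by linear_combination h1' / 2
    have e2 : (n : ℂ) = (s - d + 1) / 2 := by linear_combination h2' / 2
    rw [e1, e2]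
    simp only [cπ]
    ring
  have q1 : HasSum ((fun c : ℤ × ℤ => _) ∘ Equiv.ofBijective _ thEquivFun_bij) _ :=
    HasSum.sum (a := -1 * (thE τ x * thO τ y)) (b := 1 * (thO τ x * thE τ y))
      (f := (fun c : ℤ × ℤ => ((-1 : ℂ) ^ c.1 *
      Complex.exp (cπ * I * τ * ((c.1 : ℂ) - 1/2)^2 + cπ * I * (2*(c.1 : ℂ) - 1) * (x + y))) *
      ((-1 : ℂ) ^ c.2 *
      Complex.exp (cπ * I * τ * ((c.2 : ℂ) - 1/2)^2 + cπ * I * (2*(c.2 : ℂ) - 1) * (x - y))))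
        ∘ Equiv.ofBijective _ thEquivFun_bij) ?_ ?_
  · have := q0.unique q1
    rw [θf, θf]
    linear_combination (I * I) * this - (thE τ x * thO τ y - thO τ x * thE τ y) * I_mul_I
  · refine (p1.mul_left (-1)).congr_fun ?_
    rintro ⟨a, b⟩
    refine key (a + b + 1) (a - b) _ _ (by ring) (by ring) _ ?_
    rw [show a + b + 1 + (a - b) = 2 * a + 1 by ring]
    exact Odd.neg_one_zpow ⟨a, rfl⟩
  · refine (p2.mul_left 1).congr_fun ?_
    rintro ⟨a, b⟩
    refine key (a + b + 1) (a - b + 1) _ _ (by ring) (by ring) _ ?_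
    rw [show a + b + 1 + (a - b + 1) = 2 * (a + 1) by ring]
    exact Even.neg_one_zpow (even_two_mul _)

lemma theta_addition (τ u v y w : ℂ) (hτ : 0 < τ.im) :
    θf τ (u + v) * θf τ (u - v) * (θf τ (y + w) * θf τ (y - w)) =
    θf τ (u + y) * θf τ (u - y) * (θf τ (v + w) * θf τ (v - w)) -
    θf τ (u + w) * θf τ (u - w) * (θf τ (v + y) * θf τ (v - y)) := by
  simp only [thetaf_mul _ _ _ hτ]
  ring

lemma thetaf_zero (τ : ℂ) (hτ : 0 < τ.im) : θf τ 0 = 0 := by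
  have := thetaf_mul τ 0 0 hτ
  simp only [add_zero, sub_zero] at this
  have h2 : θf τ 0 * θf τ 0 = 0 := by rw [this]; ring
  simpa using h2

lemma theta_addition_deriv (τ u v y : ℂ) (hτ : 0 < τ.im) :
    θf τ (u + v) * θf τ (u - v) * (θf τ (2 * y) * deriv (θf τ) 0) =
    (deriv (θf τ) (u + y) * θf τ (u - y) - θf τ (u + y) * deriv (θf τ) (u - y))
      * (θf τ (v + y) * θf τ (v - y)) -
    θf τ (u + y) * θf τ (u - y) *
      (deriv (θf τ) (v + y) * θf τ (v - y) - θf τ (v + y) * deriv (θf τ) (v - y)) := by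
  have hd (z : ℂ) : HasDerivAt (θf τ) (deriv (θf τ) z) z :=
    (thetaf_hasDerivAt τ z hτ).differentiableAt.hasDerivAt
  have hp (z : ℂ) : HasDerivAt (fun w => θf τ (z + w)) (deriv (θf τ) (z + y)) y := by
    simpa using (hd (z + y)).comp_const_add z y
  have hm (z : ℂ) : HasDerivAt (fun w => θf τ (z - w)) (-deriv (θf τ) (z - y)) y := by
    simpa using (hd (z - y)).comp_const_sub z y
  have h1 := ((hp y).mul (hm y)).const_mul (θf τ (u + v) * θf τ (u - v))
  have h2 := (((hp v).mul (hm v)).const_mul (θf τ (u + y) * θf τ (u - y))).sub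
    (((hp u).mul (hm u)).mul_const (θf τ (v + y) * θf τ (v - y)))
  have h3 := h1.unique (h2.congr_of_eventuallyEq
    (Filter.Eventually.of_forall fun w => theta_addition τ u v y w hτ))
  have h0 := thetaf_zero τ hτ
  simp only [sub_self, h0] at h3
  rw [← two_mul] at h3
  linear_combination -h3

/-- Finite q-factorial `(q;q)_n`. -/
def qfac (q : ℂ) (n : ℕ) : ℂ := ∏ i ∈ Finset.range n, (1 - q * q ^ i)

/-- Gaussian binomial coefficients. -/
def gbin (q : ℂ) : ℕ → ℕ → ℂ
  | _, 0 => 1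
  | 0, _ + 1 => 0
  | N + 1, k + 1 => gbin q N k + q ^ (k + 1) * gbin q N (k + 1)

lemma gbin_zero_right (q : ℂ) (N : ℕ) : gbin q N 0 = 1 := by cases N <;> rfl

lemma gbin_of_lt (q : ℂ) (N k : ℕ) (h : N < k) : gbin q N k = 0 := by
  induction N generalizing k with
  | zero => obtain ⟨k, rfl⟩ := Nat.exists_eq_succ_of_ne_zero (by omega : k ≠ 0); rfl
  | succ N ih =>
    obtain ⟨k, rfl⟩ := Nat.exists_eq_succ_of_ne_zero (by omega : k ≠ 0)
    simp only [gbin]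
    rw [ih k (by omega), ih (k + 1) (by omega)]
    ring

lemma gbin_self (q : ℂ) (N : ℕ) : gbin q N N = 1 := by
  induction N with
  | zero => rfl
  | succ N ih => simp [gbin, ih, gbin_of_lt]

lemma qfac_succ (q : ℂ) (n : ℕ) : qfac q (n + 1) = qfac q n * (1 - q ^ (n + 1)) := by
  rw [qfac, Finset.prod_range_succ, ← qfac]; ring

lemma gbin_mul (q : ℂ) (a b : ℕ) :
    gbin q (a + b) a * qfac q a * qfac q b = qfac q (a + b) := by
  induction h : a + b generalizing a b with
  | zero =>
    obtain ⟨rfl, rfl⟩ : a = 0 ∧ b = 0 := by omega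
    simp [gbin_zero_right, qfac]
  | succ N ih =>
    rcases a with _ | a
    · obtain rfl : b = N + 1 := by omega
      simp [gbin_zero_right, qfac]
    rcases b with _ | b
    · obtain rfl : a = N := by omega
      rw [gbin_self]; simp [qfac]
    have h1 := ih a (b + 1) (by omega)
    have h2 := ih (a + 1) b (by omega)
    rw [gbin, qfac_succ q N, show N = a + b + 1 by omega]
    rw [show N = a + b + 1 by omega] at h1 h2
    rw [qfac_succ q b] at h1 ⊢
    rw [qfac_succ q a] at h2 ⊢
    linear_combination (1 - q ^ (a + 1)) * h1 + q ^ (a + 1) * (1 - q ^ (b + 1)) * h2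

lemma q_binomial (q x : ℂ) (N : ℕ) :
    ∏ j ∈ Finset.range N, (1 + x * q ^ j) =
      ∑ k ∈ Finset.range (N + 1), gbin q N k * q ^ (k.choose 2) * x ^ k := by
  induction N generalizing x with
  | zero => simp [gbin]
  | succ N ih =>
    rw [Finset.prod_range_succ']
    have e : ∀ j, 1 + x * q ^ (j + 1) = 1 + (x * q) * q ^ j := fun j => by ring
    simp_rw [e]
    rw [ih, Finset.sum_range_succ' _ (N + 1)]
    simp only [gbin]
    have hc (k : ℕ) : (k + 1).choose 2 = k + k.choose 2 := by
      rw [Nat.choose_succ_succ' k 1, Nat.choose_one_right]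
    have hs : ∑ k ∈ Finset.range (N + 1), (gbin q N k + q ^ (k + 1) * gbin q N (k + 1)) *
        q ^ ((k + 1).choose 2) * x ^ (k + 1) =
        x * ∑ k ∈ Finset.range (N + 1), gbin q N k * q ^ (k.choose 2) * (x * q) ^ k +
        ∑ k ∈ Finset.range (N + 1),
          gbin q N (k + 1) * q ^ ((k + 1).choose 2) * (x * q) ^ (k + 1) := by
      rw [Finset.mul_sum, ← Finset.sum_add_distrib]
      refine Finset.sum_congr rfl fun k _ => ?_
      rw [hc]
      ring
    rw [hs]
    have h2 := Finset.sum_range_succ' (fun k => gbin q N k * q ^ (k.choose 2) * (x * q) ^ k) (N + 1)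
    rw [Finset.sum_range_succ, gbin_of_lt q N (N + 1) (by omega)] at h2
    simp only [gbin_zero_right] at h2 ⊢
    simp only [Nat.choose_zero_succ, pow_zero, mul_one, zero_mul, add_zero] at h2 ⊢
    linear_combination h2

/-- Summand for the derivative of theta at zero. -/
def wt (τ : ℂ) (n : ℤ) : ℂ :=
  (2 * (n : ℂ) - 1) * ((-1 : ℂ) ^ n * Complex.exp (cπ * I * τ * n * (n - 1)))

def qq (τ : ℂ) : ℂ := Complex.exp (2 * cπ * I * τ)

lemma qfac_neg (τ : ℂ) (n : ℕ) :
    (∏ j ∈ Finset.range n, (1 - (qq τ)⁻¹ ^ (j + 1))) *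
      ((-1) ^ n * Complex.exp (cπ * I * τ * n * (n + 1))) = qfac (qq τ) n := by
  induction n with
  | zero => simp [qfac]
  | succ n ih =>
    rw [Finset.prod_range_succ, qfac_succ, ← ih]
    have e : Complex.exp (cπ * I * τ * (n + 1 : ℕ) * ((n + 1 : ℕ) + 1)) =
        Complex.exp (cπ * I * τ * n * (n + 1)) * qq τ ^ (n + 1) := by
      rw [qq, ← Complex.exp_nat_mul, ← Complex.exp_add]
      congr 1
      push_cast
      ring
    rw [e]
    have hq : qq τ ≠ 0 := Complex.exp_ne_zero _
    have : (qq τ)⁻¹ ^ (n + 1) * qq τ ^ (n + 1) = 1 := by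
      rw [← mul_pow, inv_mul_cancel₀ hq, one_pow]
    linear_combination (∏ j ∈ Finset.range n, (1 - (qq τ)⁻¹ ^ (j + 1))) * (-1) ^ n *
      Complex.exp (cπ * I * τ * n * (n + 1)) * this

lemma finite_jacobi (τ : ℂ) (n : ℕ) :
    ∑ k ∈ Finset.range (2 * n + 1 + 1), wt τ ((k : ℤ) - n) * gbin (qq τ) (2 * n + 1) k =
      -2 * qfac (qq τ) n ^ 2 := by
  set q := qq τ with hqdef
  have hq : q ≠ 0 := Complex.exp_ne_zero _
  set x₀ : ℂ := -(q⁻¹) ^ n with hx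
  have hx0 : x₀ * q ^ n = -1 := by
    rw [hx, neg_mul, ← mul_pow, inv_mul_cancel₀ hq, one_pow]
  set s : ℂ := (-1) ^ n * Complex.exp (cπ * I * τ * n * (n + 1)) with hs
  set R : ℂ → ℂ := fun x => (∏ j ∈ Finset.range n, (1 + x * q ^ j)) *
    ∏ j ∈ Finset.range n, (1 + x * q ^ (n + 1 + j)) with hR
  have hprod (x : ℂ) : (1 + x * q ^ n) * R x =
      ∑ k ∈ Finset.range (2 * n + 1 + 1), gbin q (2 * n + 1) k * q ^ (k.choose 2) * x ^ k := by
    rw [← q_binomial, show 2 * n + 1 = n + 1 + n by ring, Finset.prod_range_add,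
      Finset.prod_range_succ]
    simp only [hR]
    ring
  have hRd : DifferentiableAt ℂ R x₀ := by
    simp only [hR]
    fun_prop
  have hd1 : HasDerivAt (fun x => (1 + x * q ^ n) * R x) (q ^ n * R x₀) x₀ := by
    have h1 : HasDerivAt (fun x : ℂ => 1 + x * q ^ n) (q ^ n) x₀ := by
      simpa using ((hasDerivAt_id x₀).mul_const (q ^ n)).const_add 1
    refine (h1.mul hRd.hasDerivAt).congr_deriv ?_
    rw [hx0]; ring
  have hd2 : HasDerivAt (fun x => ∑ k ∈ Finset.range (2 * n + 1 + 1),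
      gbin q (2 * n + 1) k * q ^ (k.choose 2) * x ^ k)
      (∑ k ∈ Finset.range (2 * n + 1 + 1),
      gbin q (2 * n + 1) k * q ^ (k.choose 2) * (k * x₀ ^ (k - 1))) x₀ :=
    HasDerivAt.fun_sum fun k _ => (hasDerivAt_pow k x₀).const_mul _
  simp_rw [hprod] at hd1
  have hD := hd2.unique hd1
  have hZ := hprod x₀
  rw [hx0] at hZ
  have hR0 : s * R x₀ = qfac q n ^ 2 := by
    have e1 : ∏ j ∈ Finset.range n, (1 + x₀ * q ^ j) =
        ∏ j ∈ Finset.range n, (1 - q⁻¹ ^ (j + 1)) := by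
      rw [← Finset.prod_range_reflect]
      refine Finset.prod_congr rfl fun j hj => ?_
      have hj := Finset.mem_range.1 hj
      obtain ⟨m, rfl⟩ : ∃ m, n = m + (j + 1) := ⟨n - (j + 1), by omega⟩
      rw [show m + (j + 1) - 1 - j = m by omega, hx, pow_add]
      have : q⁻¹ ^ m * q ^ m = 1 := by rw [← mul_pow, inv_mul_cancel₀ hq, one_pow]
      linear_combination -q⁻¹ ^ (j + 1) * this
    have e2 : ∏ j ∈ Finset.range n, (1 + x₀ * q ^ (n + 1 + j)) = qfac q n := by
      rw [qfac]
      refine Finset.prod_congr rfl fun j hj => ?_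
      linear_combination q * q ^ j * hx0
    simp only [hR]
    rw [e1, e2]
    linear_combination qfac q n * qfac_neg τ n
  have hterm (k : ℕ) : s * (q ^ (k.choose 2) * x₀ ^ k) =
      (-1 : ℂ) ^ ((k : ℤ) - n) *
        Complex.exp (cπ * I * τ * ((k : ℤ) - n : ℤ) * (((k : ℤ) - n : ℤ) - 1)) := by
    have a1 : x₀ ^ k = (-1) ^ k * Complex.exp (-(2 * cπ * I * τ) * (n * k)) := by
      rw [hx, neg_pow, hqdef, qq, ← Complex.exp_neg, ← pow_mul, ← Complex.exp_nat_mul]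
      congr 2
      push_cast
      ring
    have a2 : q ^ (k.choose 2) = Complex.exp (2 * cπ * I * τ * ((k : ℂ) * (k - 1) / 2)) := by
      rw [hqdef, qq, ← Complex.exp_nat_mul, Nat.cast_choose_two]
      congr 1
      ring
    have a3 : (-1 : ℂ) ^ ((k : ℤ) - n) = (-1) ^ n * (-1) ^ k := by
      rw [zpow_sub₀ (by norm_num), zpow_natCast, zpow_natCast, div_eq_mul_inv, ← inv_pow]
      norm_num
      ring
    rw [hs, a1, a2, a3]
    have a4 : Complex.exp (cπ * I * τ * ((k : ℤ) - n : ℤ) * (((k : ℤ) - n : ℤ) - 1)) =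
      Complex.exp (cπ * I * τ * n * (n + 1)) *
        Complex.exp (2 * cπ * I * τ * ((k : ℂ) * (k - 1) / 2)) *
        Complex.exp (-(2 * cπ * I * τ) * (n * k)) := by
      rw [← Complex.exp_add, ← Complex.exp_add]
      congr 1
      push_cast
      ring
    rw [a4]
    ring
  have hxD : ∑ k ∈ Finset.range (2 * n + 1 + 1),
      gbin q (2 * n + 1) k * q ^ (k.choose 2) * (k * x₀ ^ k) = - R x₀ := by
    have : x₀ * (q ^ n * R x₀) = - R x₀ := by linear_combination R x₀ * hx0
    rw [← this, ← hD, Finset.mul_sum]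
    refine Finset.sum_congr rfl fun k _ => ?_
    rcases k with _ | k
    · simp
    · rw [Nat.add_sub_cancel]; ring
  have hfin : ∑ k ∈ Finset.range (2 * n + 1 + 1), wt τ ((k : ℤ) - n) * gbin q (2 * n + 1) k =
      2 * s * (∑ k ∈ Finset.range (2 * n + 1 + 1),
        gbin q (2 * n + 1) k * q ^ (k.choose 2) * (k * x₀ ^ k)) -
      (2 * n + 1) * s * (∑ k ∈ Finset.range (2 * n + 1 + 1),
        gbin q (2 * n + 1) k * q ^ (k.choose 2) * x₀ ^ k) := by
    rw [Finset.mul_sum, Finset.mul_sum, ← Finset.sum_sub_distrib]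
    refine Finset.sum_congr rfl fun k _ => ?_
    rw [wt, ← hterm]
    push_cast
    ring
  rw [hfin, hxD, ← hZ]
  linear_combination -2 * hR0

open Filter Topology in
lemma jacobi_cube (τ : ℂ) (hτ : 0 < τ.im) (hw : Summable (wt τ)) :
    qPoch (qq τ) (qq τ) ≠ 0 ∧ ∑' k, wt τ k = -2 * qPoch (qq τ) (qq τ) ^ 3 := by
  set q := qq τ with hqdef
  have hq1 : ‖q‖ < 1 := by
    rw [hqdef, qq, Complex.norm_exp, Real.exp_lt_one_iff]
    have : (2 * cπ * I * τ).re = -(2 * Real.pi * τ.im) := by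
      simp [cπ]
    rw [this]
    have := Real.pi_pos
    have : 0 < 2 * Real.pi * τ.im := by positivity
    linarith
  have hsum : Summable fun i : ℕ => ‖-(q * q ^ i)‖ := by
    simp only [norm_neg, norm_mul, norm_pow]
    exact (summable_geometric_of_lt_one (norm_nonneg _) hq1).mul_left _
  have hne (i : ℕ) : 1 - q * q ^ i ≠ 0 := by
    intro h
    have h1 : ‖q ^ (i + 1)‖ = 1 := by
      rw [show q ^ (i + 1) = 1 by linear_combination -h, norm_one]
    rw [norm_pow] at h1
    exact (pow_lt_one₀ (norm_nonneg _) hq1 (by omega)).ne h1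
  have hP0 : qPoch q q ≠ 0 := by
    have := tprod_one_add_ne_zero_of_summable (f := fun i : ℕ => -(q * q ^ i))
      (fun i => by simpa [sub_eq_add_neg] using hne i) hsum
    simpa [qPoch, sub_eq_add_neg] using this
  have hlim : Tendsto (qfac q) atTop (𝓝 (qPoch q q)) := by
    have := (multipliable_one_add_of_summable hsum).hasProd.tendsto_prod_nat
    have e : qfac q = fun n => ∏ i ∈ Finset.range n, (1 + -(q * q ^ i)) := by
      funext n; simp [qfac, sub_eq_add_neg]
    rw [e]
    simpa [qPoch, sub_eq_add_neg] using this
  have hf0 (n : ℕ) : qfac q n ≠ 0 := Finset.prod_ne_zero_iff.2 fun i _ => hne i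
  have hlimi : Tendsto (fun n => (qfac q n)⁻¹) atTop (𝓝 (qPoch q q)⁻¹) := hlim.inv₀ hP0
  obtain ⟨B, hB⟩ := (Metric.isBounded_range_of_tendsto _ hlim).exists_norm_le
  obtain ⟨M, hM⟩ := (Metric.isBounded_range_of_tendsto _ hlimi).exists_norm_le
  replace hB (n : ℕ) : ‖qfac q n‖ ≤ B := hB _ ⟨n, rfl⟩
  replace hM (n : ℕ) : ‖(qfac q n)⁻¹‖ ≤ M := hM _ ⟨n, rfl⟩
  have hB0 : 0 ≤ B := (norm_nonneg _).trans (hB 0)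
  have hM0 : 0 ≤ M := (norm_nonneg _).trans (hM 0)
  refine ⟨hP0, ?_⟩
  set f : ℕ → ℤ → ℂ := fun n k => if k ∈ Finset.Icc (-(n : ℤ)) (n + 1) then
    wt τ k * (qfac q (2 * n + 1) * (qfac q (n + k).toNat)⁻¹ * (qfac q (n + 1 - k).toNat)⁻¹)
    else 0 with hf
  have htend : Tendsto (fun n => ∑' k, f n k) atTop
      (𝓝 (∑' k, wt τ k * (qPoch q q * (qPoch q q)⁻¹ * (qPoch q q)⁻¹))) := by
    refine tendsto_tsum_of_dominated_convergence (bound := fun k => ‖wt τ k‖ * (B * M * M))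
      (hw.norm.mul_right _) (fun k => ?_) (Eventually.of_forall fun n k => ?_)
    · have t1 : Tendsto (fun n : ℕ => 2 * n + 1) atTop atTop :=
        tendsto_atTop_mono (fun n => by simp only [id]; omega) tendsto_id
      have t2 : Tendsto (fun n : ℕ => ((n : ℤ) + k).toNat) atTop atTop := by
        refine tendsto_atTop.2 fun b => ?_
        filter_upwards [eventually_ge_atTop (b + k.natAbs)] with n hn
        omega
      have t3 : Tendsto (fun n : ℕ => ((n : ℤ) + 1 - k).toNat) atTop atTop := by
        refine tendsto_atTop.2 fun b => ?_
        filter_upwards [eventually_ge_atTop (b + k.natAbs)] with n hn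
        omega
      have := (((hlim.comp t1).mul (hlimi.comp t2)).mul (hlimi.comp t3)).const_mul (wt τ k)
      refine this.congr' ?_
      filter_upwards [eventually_ge_atTop k.natAbs] with n hn
      simp only [hf]
      rw [if_pos (by rw [Finset.mem_Icc]; omega)]
      rfl
    · simp only [hf]
      split_ifs with h
      · rw [norm_mul, norm_mul, norm_mul]
        gcongr
        · exact hB _
        · exact hM _
        · exact hM _
      · rw [norm_zero]; positivity
  have hval (n : ℕ) : ∑' k, f n k = -2 * qfac q n ^ 2 := by
    rw [← finite_jacobi τ n, tsum_eq_sum (s := Finset.Icc (-(n : ℤ)) (n + 1))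
      (fun k hk => by simp only [hf]; rw [if_neg hk])]
    refine Finset.sum_nbij' (fun k => ((n : ℤ) + k).toNat) (fun k => (k : ℤ) - n) ?_ ?_ ?_ ?_ ?_
    · intro k hk
      rw [Finset.mem_Icc] at hk
      rw [Finset.mem_range]; omega
    · intro k hk
      rw [Finset.mem_range] at hk
      rw [Finset.mem_Icc]; omega
    · intro k hk
      rw [Finset.mem_Icc] at hk
      omega
    · intro k hk
      rw [Finset.mem_range] at hk
      omega
    · intro k hk
      simp only [hf]
      rw [if_pos hk]
      rw [Finset.mem_Icc] at hk
      rw [show (((n : ℤ) + k).toNat : ℤ) - n = k by omega]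
      have h := gbin_mul q ((n : ℤ) + k).toNat ((n : ℤ) + 1 - k).toNat
      rw [show ((n : ℤ) + k).toNat + ((n : ℤ) + 1 - k).toNat = 2 * n + 1 by omega] at h
      rw [← h, ← hqdef]
      have h1 := hf0 ((n : ℤ) + k).toNat
      have h2 := hf0 ((n : ℤ) + 1 - k).toNat
      field_simp
  simp_rw [hval] at htend
  have hfin := tendsto_nhds_unique htend ((hlim.pow 2).const_mul (-2))
  rw [tsum_mul_right] at hfin
  field_simp at hfin
  linear_combination hfin

/-- The partial-fraction identity for theta functions obtained by
differentiating the addition formula, together with θ′(0) = 2π p^{1/8}(p;p)_∞³. -/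
theorem theta_log_deriv_identity
    (t : ℝ) (ht : 0 < t) (τ : ℂ) (hτ : τ = t * I)
    (u v y : ℂ)
    (h1 : θf τ (u + y) ≠ 0) (h2 : θf τ (u - y) ≠ 0)
    (h3 : θf τ (v + y) ≠ 0) (h4 : θf τ (v - y) ≠ 0)
    (h5 : θf τ (2*y) ≠ 0) :
    (θf τ (u + v) * θf τ (u - v) /
        (θf τ (u + y) * θf τ (u - y) * θf τ (v + y) * θf τ (v - y)) =
      (1 / (deriv (θf τ) 0 * θf τ (2*y))) *
        (deriv (θf τ) (u + y) / θf τ (u + y) - deriv (θf τ) (u - y) / θf τ (u - y)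
          + deriv (θf τ) (v - y) / θf τ (v - y)
          - deriv (θf τ) (v + y) / θf τ (v + y))) ∧
    deriv (θf τ) 0 = 2*cπ * Complex.exp (2*cπ*I*τ*(1/8)) *
      (qPoch (Complex.exp (2*cπ*I*τ)) (Complex.exp (2*cπ*I*τ)))^3 := by
  have hτ' : 0 < τ.im := by rw [hτ]; simpa using ht
  have hs := thetaf_deriv_zero τ hτ'
  obtain ⟨hP, hc⟩ := jacobi_cube τ hτ' hs.summable
  have hcp : cπ ≠ 0 := by simp [cπ, Real.pi_ne_zero]
  have hd : deriv (θf τ) 0 = 2*cπ * Complex.exp (2*cπ*I*τ*(1/8)) *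
      (qPoch (Complex.exp (2*cπ*I*τ)) (Complex.exp (2*cπ*I*τ)))^3 := by
    have h := hs.tsum_eq.symm.trans hc
    rw [show 2*cπ*I*τ*(1/8) = cπ * I * τ / 4 by ring]
    have he := Complex.exp_ne_zero (cπ * I * τ / 4)
    rw [div_eq_iff (mul_ne_zero hcp he)] at h
    simp only [qq] at h
    linear_combination -h
  have hd0 : deriv (θf τ) 0 ≠ 0 := by
    rw [hd]
    exact mul_ne_zero (mul_ne_zero (mul_ne_zero two_ne_zero hcp) (Complex.exp_ne_zero _))
      (pow_ne_zero 3 hP)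
  refine ⟨?_, hd⟩
  have key := theta_addition_deriv τ u v y hτ'
  generalize θf τ (2 * y) = z at *
  field_simp
  linear_combination key
end
end
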